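/- arXiv:math/9807029 — 2 statements merged into one kernel-verified Lean document; each statement's English description precedes it below -/
import Mathlib

section
/- For odd d, let k(d) = 3·2^{(d+1)/2} + 4 and let A_{3σ+4}(d) denote the rational number B_{k(d)}(d)/d. Then A_{3σ+4}(3) = 1, A_{3σ+4}(5) = 1, A_{3σ+4}(7) = 5, A_{3σ+4}(9) = 7, and for every odd d ≥ 11, A_{3σ+4}(d) = A_{3σ+4}(d−2) + 3·A_{3σ+4}(d−4) − A_{3σ+4}(d−6) − A_{3σ+4}(d−8) + 1. -/
/-- `sBin d x` is the number of 1's in the binary representation of the reduction of `x`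
modulo `2^d - 1`. -/
def sBin (d x : ℕ) : ℕ := (Nat.digits 2 (x % (2 ^ d - 1))).count 1

/-- `B k d` is the number of `a` with `0 < a < 2^d - 1` such that
`s(a) + s((k-1)a) = s(ka) + 1`. -/
def B (k d : ℕ) : ℕ :=
  ((Finset.Ioo 0 (2 ^ d - 1)).filter
    (fun a => sBin d a + sBin d ((k - 1) * a) = sBin d (k * a) + 1)).card

/-- `AGII d = B_{3σ+4}(d) / d` where `σ = 2^{(d+1)/2}` (the Glynn type (II) exponent). -/
noncomputable def AGII (d : ℕ) : ℚ := (B (3 * 2 ^ ((d + 1) / 2) + 4) d : ℚ) / d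


namespace GlynnII

/-- A state of the carry automaton: three bits, two carries of the first addition,
two carries of the second addition. -/
abbrev St := ℕ × ℕ × ℕ × ℕ × ℕ × ℕ × ℕ

set_option synthInstance.maxHeartbeats 200000 in
set_option synthInstance.maxSize 1000 in
instance instDecSt : DecidableEq St := inferInstance

/-- Transition of the carry automaton on reading the bit `b`. -/
def step (s : St) (b : ℕ) : St :=
  match s with
  | (b1, b2, b3, q1, q2, e1, e2) =>
    (b, b1, b2, (b + b1 + b2 + b3 + q2) / 2, q1, (b + (b + b1 + b2 + b3 + q2) % 2 + e2) / 2, e1)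

/-- Current carry of the second addition. -/
def ee (s : St) : ℕ := s.2.2.2.2.2.1

/-- Number of words of length `n+1` leading from `s` to `T` with no intermediate carry. -/
def V (T : St) : ℕ → St → ℕ
  | 0, s => (if step s 0 = T then 1 else 0) + (if step s 1 = T then 1 else 0)
  | n + 1, s => (if ee (step s 0) = 0 then V T n (step s 0) else 0) +
      (if ee (step s 1) = 0 then V T n (step s 1) else 0)

/-- The states with carry pattern `(1, 0)`. -/
def S10 : Finset St :=
  Finset.range 2 ×ˢ Finset.range 2 ×ˢ Finset.range 2 ×ˢ Finset.range 4 ×ˢ Finset.range 4 ×ˢ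
    ({1} : Finset ℕ) ×ˢ ({0} : Finset ℕ)

/-- A closed set of carry-free states. -/
def Gbig : List St :=
  [(0, 0, 0, 0, 0, 0, 0), (0, 0, 0, 0, 1, 0, 0), (0, 0, 0, 0, 2, 0, 0), (0, 0, 0, 1, 0, 0, 0), (0,
   0, 0, 1, 1, 0, 0), (0, 0, 0, 1, 2, 0, 0), (0, 0, 0, 2, 1, 0, 0), (0, 0, 0, 2, 2, 0, 0), (0,
   0, 1, 1, 0, 0, 0), (0, 0, 1, 1, 1, 0, 0), (0, 0, 1, 1, 2, 0, 0), (0, 0, 1, 2, 1, 0, 0), (0,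
   0, 1, 2, 2, 0, 0), (0, 0, 1, 2, 3, 0, 0), (0, 1, 0, 0, 1, 0, 0), (0, 1, 0, 1, 1, 0, 0), (0,
   1, 0, 1, 2, 0, 0), (0, 1, 0, 1, 3, 0, 0), (0, 1, 0, 2, 2, 0, 0), (0, 1, 0, 2, 3, 0, 0), (0,
   1, 1, 1, 1, 0, 0), (0, 1, 1, 1, 2, 0, 0), (0, 1, 1, 2, 2, 0, 0), (0, 1, 1, 2, 3, 0, 0), (0,
   1, 1, 3, 3, 0, 0), (1, 0, 0, 1, 0, 0, 0), (1, 0, 0, 1, 1, 0, 0), (1, 0, 0, 1, 2, 0, 0), (1,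
   0, 0, 2, 1, 0, 0), (1, 0, 0, 2, 2, 0, 0), (1, 0, 1, 2, 1, 0, 0), (1, 0, 1, 2, 2, 0, 0), (1,
   0, 1, 3, 1, 0, 0), (1, 0, 1, 3, 2, 0, 0), (1, 0, 1, 3, 3, 0, 0), (1, 1, 0, 1, 1, 0, 0), (1,
   1, 0, 2, 1, 0, 0), (1, 1, 0, 2, 2, 0, 0), (1, 1, 0, 2, 3, 0, 0), (1, 1, 0, 3, 3, 0, 0), (1,
   1, 1, 2, 1, 0, 0), (1, 1, 1, 2, 2, 0, 0), (1, 1, 1, 3, 2, 0, 0), (1, 1, 1, 3, 3, 0, 0)]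

/-- The relevant carry-free states. -/
def G : List St :=
  [(0, 0, 0, 0, 0, 0, 0), (0, 0, 0, 0, 1, 0, 0), (0, 0, 0, 1, 1, 0, 0), (0, 0, 0, 1, 2, 0, 0), (0,
   0, 1, 1, 0, 0, 0), (0, 0, 1, 1, 1, 0, 0), (0, 0, 1, 2, 2, 0, 0), (0, 1, 0, 0, 1, 0, 0), (0,
   1, 0, 1, 1, 0, 0), (0, 1, 0, 1, 2, 0, 0), (0, 1, 1, 1, 1, 0, 0), (0, 1, 1, 2, 2, 0, 0), (1,
   0, 0, 1, 0, 0, 0), (1, 0, 0, 1, 1, 0, 0), (1, 0, 0, 2, 2, 0, 0), (1, 0, 1, 2, 1, 0, 0), (1,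
   1, 0, 1, 1, 0, 0), (1, 1, 0, 2, 2, 0, 0), (1, 1, 1, 2, 1, 0, 0)]

/-- Transition table on `G`. -/
def tab : List (ℕ × ℕ) :=
  [(0, 99), (0, 12), (1, 13), (2, 99), (1, 13), (2, 99), (3, 14), (4, 99), (5, 99), (5, 15), (5,
   15), (6, 99), (7, 16), (8, 99), (9, 17), (9, 17), (10, 18), (11, 99), (11, 99)]

/-- The starting states which can be reached from `Gbig`. -/
def Tgood : List St :=
  [(1, 0, 0, 0, 0, 1, 0), (1, 0, 0, 0, 1, 1, 0), (1, 0, 0, 1, 0, 1, 0), (1, 0, 0, 1, 1, 1, 0), (1,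
   0, 0, 1, 2, 1, 0), (1, 0, 0, 2, 2, 1, 0), (1, 0, 1, 1, 0, 1, 0), (1, 0, 1, 1, 1, 1, 0), (1,
   0, 1, 2, 1, 1, 0), (1, 0, 1, 2, 2, 1, 0), (1, 1, 0, 1, 1, 1, 0), (1, 1, 0, 1, 2, 1, 0), (1,
   1, 0, 2, 2, 1, 0), (1, 1, 0, 2, 3, 1, 0), (1, 1, 1, 2, 2, 1, 0), (1, 1, 1, 3, 3, 1, 0)]

/-- All states reachable in `k` carry-free steps. -/
def ends : ℕ → St → List St
  | 0, s => [s]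
  | k + 1, s => (if ee (step s 0) = 0 then ends k (step s 0) else []) ++
      (if ee (step s 1) = 0 then ends k (step s 1) else [])

def nextv (v : List ℕ) : List ℕ := tab.map (fun p => v.getD p.1 0 + v.getD p.2 0)

def vec (T : St) : ℕ → List ℕ
  | 0 => G.map (V T 0)
  | n + 1 => nextv (vec T n)

lemma nextv_map (f : St → ℕ) : nextv (G.map f) = G.map (fun s =>
    (if ee (step s 0) = 0 then f (step s 0) else 0) +
      (if ee (step s 1) = 0 then f (step s 1) else 0)) := by
  rfl

lemma vec_eq (T : St) (n : ℕ) : vec T n = G.map (V T n) := by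
  induction n with
  | zero => rfl
  | succ n ih => rw [vec, ih, nextv_map]; rfl

def ladd (l m : List ℕ) : List ℕ := List.zipWith (· + ·) l m
def lmul (c : ℕ) (l : List ℕ) : List ℕ := l.map (c * ·)

/-- The linear recurrence satisfied by all counting sequences. -/
def Rec (f : ℕ → ℕ) (n : ℕ) : Prop :=
  f (n + 16) + 3 * f (n + 10) + 8 * f (n + 8) + f (n + 2) + f n =
    f (n + 14) + 5 * f (n + 12) + 3 * f (n + 6) + 5 * f (n + 4)

instance (f : ℕ → ℕ) (n : ℕ) : Decidable (Rec f n) := by unfold Rec; infer_instance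

lemma rec_base : ∀ T ∈ Tgood, ∀ i ∈ List.range 19, Rec (fun n => (vec T n).getD i 0) 3 := by
  decide +kernel

lemma G_closed : ∀ s ∈ G, ∀ b ∈ [0, 1], ee (step s b) = 0 → step s b ∈ G := by
  decide +kernel

lemma Gbig_closed : ∀ s ∈ Gbig, ∀ b ∈ [0, 1], ee (step s b) = 0 → step s b ∈ Gbig := by
  decide +kernel

lemma Gbig_Tgood : ∀ s ∈ Gbig, ∀ b ∈ [0, 1], ee (step s b) = 1 → step s b ∈ Tgood := by
  decide +kernel

lemma ends_Tgood : ∀ T ∈ Tgood, ∀ s ∈ ends 3 T, s ∈ G := by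
  decide +kernel

lemma Tgood_sub : ∀ T ∈ Tgood, T ∈ S10 := by
  decide +kernel

lemma Tgood_nodup : Tgood.Nodup := by
  decide +kernel

lemma ends_S10 : ∀ T ∈ S10, ∀ s ∈ ends 3 T, s ∈ Gbig := by
  decide +kernel

/-- Computable version of the total count. -/
def Fc (n : ℕ) : ℕ :=
  (Tgood.map fun T => ((ends 3 T).map fun s => (vec T n).getD (G.idxOf s) 0).sum).sum

lemma Fc_vals : (List.range 9).map (fun j => Fc (2 * j + 1)) =
    [1, 5, 7, 21, 37, 89, 173, 383, 777] := by
  decide +kernel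

lemma V_ends (T : St) (n : ℕ) : ∀ (k : ℕ) (s : St),
    V T (n + k) s = ((ends k s).map (V T n)).sum := by
  intro k
  induction k with
  | zero => intro s; simp [ends]
  | succ k ih =>
    intro s
    rw [← Nat.add_assoc, V, ends, List.map_append, List.sum_append, ih, ih]
    congr 1 <;> split_ifs <;> simp

lemma V_zero (T : St) (hT : T ∈ S10) (hT' : T ∉ Tgood) :
    ∀ (n : ℕ) (s : St), s ∈ Gbig → V T n s = 0 := by
  have h1 : ee T = 1 := by
    simp only [S10, Finset.mem_product, Finset.mem_singleton] at hT
    exact hT.2.2.2.2.2.1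
  intro n
  induction n with
  | zero =>
    intro s hs
    have h : ∀ b ∈ [0, 1], step s b ≠ T := by
      intro b hb h
      apply hT'
      rw [← h]
      exact Gbig_Tgood s hs b hb (by rw [h]; exact h1)
    simp [V, h 0 (by simp), h 1 (by simp)]
  | succ n ih =>
    intro s hs
    have h : ∀ b ∈ [0, 1], (if ee (step s b) = 0 then V T n (step s b) else 0) = 0 := by
      intro b hb
      split_ifs with h
      · exact ih _ (Gbig_closed s hs b hb h)
      · rfl
    rw [V, h 0 (by simp), h 1 (by simp)]

lemma V_rec (T : St) (hT : T ∈ Tgood) :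
    ∀ (n : ℕ) (s : St), s ∈ G → Rec (fun n => V T n s) (n + 3) := by
  intro n
  induction n with
  | zero =>
    intro s hs
    obtain ⟨i, hi, rfl⟩ := List.mem_iff_getElem.mp hs
    have h := rec_base T hT i (by rw [List.mem_range]; exact hi)
    have hv : ∀ n, (vec T n).getD i 0 = V T n G[i] := by
      intro n
      rw [vec_eq, List.getD_eq_getElem?_getD, List.getElem?_map, List.getElem?_eq_getElem hi]
      rfl
    simpa only [hv, Nat.zero_add] using h
  | succ n ih =>
    intro s hs
    have h0 := ih (step s 0)
    have h1 := ih (step s 1)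
    have c0 := G_closed s hs 0 (by simp)
    have c1 := G_closed s hs 1 (by simp)
    have e : ∀ k, V T (n + 1 + 3 + k) s =
      (if ee (step s 0) = 0 then V T (n + 3 + k) (step s 0) else 0) +
      (if ee (step s 1) = 0 then V T (n + 3 + k) (step s 1) else 0) := by
      intro k
      rw [show n + 1 + 3 + k = (n + 3 + k) + 1 by ring, V]
    have e0 := e 0
    simp only [Nat.add_zero] at e0
    simp only [Rec] at h0 h1 ⊢
    rw [e, e, e, e, e, e, e, e, e0]
    split_ifs with a b b
    · have := h0 (c0 a); have := h1 (c1 b); omega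
    · have := h0 (c0 a); omega
    · have := h1 (c1 b); omega
    · rfl

/-- The total count. -/
def F (n : ℕ) : ℕ := ∑ T ∈ S10, V T n T

lemma F_Tgood (n : ℕ) : F (n + 3) = ∑ T ∈ Tgood.toFinset, V T (n + 3) T := by
  unfold F
  symm
  apply Finset.sum_subset
  · intro T hT
    exact Tgood_sub T (List.mem_toFinset.mp hT)
  · intro T hT hT'
    rw [V_ends]
    apply List.sum_eq_zero
    intro x hx
    obtain ⟨s, hs, rfl⟩ := List.mem_map.mp hx
    exact V_zero T hT (fun h => hT' (List.mem_toFinset.mpr h)) n s (ends_S10 T hT s hs)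

lemma F_eq_Fc (n : ℕ) : F (n + 3) = Fc n := by
  rw [F_Tgood, List.sum_toFinset _ Tgood_nodup, Fc]
  congr 1
  apply List.map_congr_left
  intro T hT
  rw [V_ends]
  congr 1
  apply List.map_congr_left
  intro s hs
  have hi : G.idxOf s < G.length := List.idxOf_lt_length_of_mem (ends_Tgood T hT s hs)
  rw [vec_eq, List.getD_eq_getElem?_getD, List.getElem?_map, List.getElem?_eq_getElem hi]
  simp

lemma Rec_list_sum {α : Type*} (l : List α) (f : α → ℕ → ℕ) (n : ℕ)
    (h : ∀ a ∈ l, Rec (f a) n) : Rec (fun n => (l.map (fun a => f a n)).sum) n := by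
  induction l with
  | nil => simp [Rec]
  | cons a l ih =>
    have h1 := h a (by simp)
    have h2 := ih (fun b hb => h b (by simp [hb]))
    simp only [Rec, List.map_cons, List.sum_cons] at h1 h2 ⊢
    omega

lemma F_rec (n : ℕ) : Rec F (n + 6) := by
  have h : ∀ T ∈ Tgood, Rec (fun n => V T (n + 3) T) (n + 3) := by
    intro T hT
    have : (fun n => V T (n + 3) T) = fun n => ((ends 3 T).map (fun s => V T n s)).sum := by
      funext n; rw [V_ends]
    rw [this]
    apply Rec_list_sum _ (fun s n => V T n s)
    intro s hs
    exact V_rec T hT n s (ends_Tgood T hT s hs)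
  have h2 := Rec_list_sum Tgood (fun T n => V T (n + 3) T) (n + 3) h
  have e : ∀ n, F (n + 3) = (Tgood.map (fun T => V T (n + 3) T)).sum := by
    intro n
    rw [F_Tgood, List.sum_toFinset _ Tgood_nodup]
  simp only [Rec, ← e] at h2 ⊢
  convert h2 using 2

lemma F_two : F 2 = 1 := by
  decide +kernel

lemma Fc_get (n : ℕ) (hn : n < 9) :
    F (2 * n + 1 + 3) = [1, 5, 7, 21, 37, 89, 173, 383, 777].getD n 0 := by
  rw [F_eq_Fc, ← Fc_vals, List.getD_eq_getElem?_getD, List.getElem?_map,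
    List.getElem?_range hn]
  rfl

lemma F_final (m : ℕ) :
    F (2 * m + 10) + F (2 * m + 4) + F (2 * m + 2) = F (2 * m + 8) + 3 * F (2 * m + 6) + 1 := by
  have v2 := F_two
  have v4 : F 4 = 1 := Fc_get 0 (by norm_num)
  have v6 : F 6 = 5 := Fc_get 1 (by norm_num)
  have v8 : F 8 = 7 := Fc_get 2 (by norm_num)
  have v10 : F 10 = 21 := Fc_get 3 (by norm_num)
  have v12 : F 12 = 37 := Fc_get 4 (by norm_num)
  have v14 : F 14 = 89 := Fc_get 5 (by norm_num)
  have v16 : F 16 = 173 := Fc_get 6 (by norm_num)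
  have v18 : F 18 = 383 := Fc_get 7 (by norm_num)
  have v20 : F 20 = 777 := Fc_get 8 (by norm_num)
  induction m using Nat.strong_induction_on with
  | _ m ih =>
    rcases Nat.lt_or_ge m 6 with h | h
    · interval_cases m <;> simp only [Nat.mul_zero, Nat.mul_one, Nat.zero_add, Nat.reduceMul,
        Nat.reduceAdd, v2, v4, v6, v8, v10, v12, v14, v16, v18, v20]
    · obtain ⟨k, rfl⟩ := Nat.exists_eq_add_of_le h
      have r := F_rec (2 * k)
      have i1 := ih (k + 2) (by omega)
      have i2 := ih (k + 4) (by omega)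
      simp only [Rec] at r
      ring_nf at r i1 i2 ⊢
      simp only [Nat.add_comm _ (k * 2)] at r i1 i2 ⊢
      omega


/-- The words counted by `V`. -/
def Wd (T : St) : ℕ → St → Finset (List ℕ)
  | 0, s => (if step s 0 = T then {[0]} else ∅) ∪ (if step s 1 = T then {[1]} else ∅)
  | n + 1, s => (if ee (step s 0) = 0 then (Wd T n (step s 0)).image (List.cons 0) else ∅) ∪
      (if ee (step s 1) = 0 then (Wd T n (step s 1)).image (List.cons 1) else ∅)

lemma card_Wd (T : St) : ∀ (n : ℕ) (s : St), (Wd T n s).card = V T n s := by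
  intro n
  induction n with
  | zero =>
    intro s
    rw [Wd, V, Finset.card_union_of_disjoint]
    · congr 1 <;> split_ifs <;> rfl
    · split_ifs <;> simp
  | succ n ih =>
    intro s
    rw [Wd, V, Finset.card_union_of_disjoint]
    · congr 1 <;> split_ifs
      · rw [Finset.card_image_of_injective _ (List.cons_injective), ih]
      · rfl
      · rw [Finset.card_image_of_injective _ (List.cons_injective), ih]
      · rfl
    · rw [Finset.disjoint_left]
      intro w h0 h1
      split_ifs at h0 h1 <;> simp at h0 h1
      obtain ⟨a, _, rfl⟩ := h0
      obtain ⟨c, _, h⟩ := h1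
      simp at h

/-- A run of the automaton. -/
def IsRun (T : St) (n : ℕ) (s : St) (β : ℕ → ℕ) (σ : ℕ → St) : Prop :=
  σ 0 = s ∧ σ (n + 1) = T ∧ (∀ i ≤ n, (β i = 0 ∨ β i = 1) ∧ σ (i + 1) = step (σ i) (β i)) ∧
    ∀ i, 0 < i → i ≤ n → ee (σ i) = 0

lemma mem_Wd_of_run (T : St) : ∀ (n : ℕ) (s : St) (β : ℕ → ℕ) (σ : ℕ → St),
    IsRun T n s β σ → (List.range (n + 1)).map β ∈ Wd T n s := by
  intro n
  induction n with
  | zero =>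
    rintro s β σ ⟨h0, hT, hs, -⟩
    obtain ⟨hb, h1⟩ := hs 0 le_rfl
    simp only [Nat.zero_add] at h1 hT
    rw [h0, hT] at h1
    rw [Wd]
    rcases hb with hb | hb <;> rw [hb] at h1 <;> simp [← h1, hb]
  | succ n ih =>
    rintro s β σ ⟨h0, hT, hs, he⟩
    have key := ih (σ 1) (fun i => β (i + 1)) (fun i => σ (i + 1))
      ⟨rfl, hT, fun i hi => hs (i + 1) (by omega), fun i h1 h2 => he (i + 1) (by omega) (by omega)⟩
    have e1 := he 1 (by omega) (by omega)
    obtain ⟨hb, h1⟩ := hs 0 (by omega)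
    rw [Nat.zero_add, h0] at h1
    rw [h1] at key e1
    rw [Wd, List.range_succ_eq_map, List.map_cons, List.map_map]
    have key' : List.map (β ∘ Nat.succ) (List.range (n + 1)) ∈ Wd T n (step s (β 0)) := key
    rcases hb with hb | hb
    · rw [hb] at key' e1 ⊢
      simp [e1, key']
    · rw [hb] at key' e1 ⊢
      simp [e1, key']

lemma run_of_mem_Wd (T : St) : ∀ (n : ℕ) (s : St) (w : List ℕ), w ∈ Wd T n s →
    ∃ (β : ℕ → ℕ) (σ : ℕ → St), w = (List.range (n + 1)).map β ∧ IsRun T n s β σ := by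
  intro n
  induction n with
  | zero =>
    intro s w hw
    have : ∃ b, (b = 0 ∨ b = 1) ∧ w = [b] ∧ step s b = T := by
      rw [Wd, Finset.mem_union] at hw
      rcases hw with hw | hw
      · split_ifs at hw with h
        · exact ⟨0, Or.inl rfl, by simpa using hw, h⟩
        · simp at hw
      · split_ifs at hw with h
        · exact ⟨1, Or.inr rfl, by simpa using hw, h⟩
        · simp at hw
    obtain ⟨b, hb, rfl, hs⟩ := this
    refine ⟨fun _ => b, fun i => if i = 0 then s else T, by simp, by simp, by simp, ?_, ?_⟩
    · intro i hi
      obtain rfl : i = 0 := by omega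
      exact ⟨hb, by simp [hs]⟩
    · intro i h1 h2; omega
  | succ n ih =>
    intro s w hw
    have : ∃ b w', (b = 0 ∨ b = 1) ∧ w = b :: w' ∧ w' ∈ Wd T n (step s b) ∧ ee (step s b) = 0 := by
      rw [Wd, Finset.mem_union] at hw
      rcases hw with hw | hw
      · split_ifs at hw with h
        · obtain ⟨w', h1, h2⟩ := Finset.mem_image.mp hw
          exact ⟨0, w', Or.inl rfl, h2.symm, h1, h⟩
        · simp at hw
      · split_ifs at hw with h
        · obtain ⟨w', h1, h2⟩ := Finset.mem_image.mp hw
          exact ⟨1, w', Or.inr rfl, h2.symm, h1, h⟩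
        · simp at hw
    obtain ⟨b, w', hb, rfl, hw', he⟩ := this
    obtain ⟨β, σ, rfl, h0, hT, hs, hee⟩ := ih _ _ hw'
    refine ⟨fun i => Nat.casesOn i b β, fun i => Nat.casesOn i s σ, ?_, rfl, hT, ?_, ?_⟩
    · rw [List.range_succ_eq_map (n := n + 1), List.map_cons, List.map_map]
      rfl
    · intro i hi
      cases i with
      | zero => exact ⟨hb, h0⟩
      | succ i => exact hs i (by omega)
    · intro i h1 h2
      cases i with
      | zero => omega
      | succ i =>
        cases i with
        | zero => show ee (σ 0) = 0; rw [h0]; exact he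
        | succ i => exact hee (i + 1) (by omega) (by omega)


section Arith

variable {M : ℕ} [NeZero M]

/-- Top bit. -/
def bb (x : ZMod M) : ℕ := (2 * x.val) / M

/-- Carry of the first addition. -/
def qq (σ x : ZMod M) : ℕ :=
  (x.val + (σ * x).val + (2 * x).val + (2 * (σ * x)).val) / M

/-- Carry of the second addition. -/
def ec (σ x : ZMod M) : ℕ := (x.val + ((3 * σ + 3) * x).val) / M

lemma bb_spec (x : ZMod M) : 2 * x.val = M * bb x + (2 * x).val := by
  have h : (2 * x).val = (2 * x.val) % M := by
    rw [← ZMod.val_natCast]; push_cast; rw [ZMod.natCast_zmod_val]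
  rw [h, bb, Nat.div_add_mod]

lemma qq_spec (σ x : ZMod M) : x.val + (σ * x).val + (2 * x).val + (2 * (σ * x)).val =
    M * qq σ x + ((3 * σ + 3) * x).val := by
  have h : ((3 * σ + 3) * x).val =
      (x.val + (σ * x).val + (2 * x).val + (2 * (σ * x)).val) % M := by
    rw [← ZMod.val_natCast]; push_cast; simp only [ZMod.natCast_zmod_val]
    congr 1; ring
  rw [h, qq, Nat.div_add_mod]

lemma ec_spec (σ x : ZMod M) : x.val + ((3 * σ + 3) * x).val =
    M * ec σ x + ((3 * σ + 4) * x).val := by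
  have h : ((3 * σ + 4) * x).val = (x.val + ((3 * σ + 3) * x).val) % M := by
    rw [← ZMod.val_natCast]; push_cast; simp only [ZMod.natCast_zmod_val]
    congr 1; ring
  rw [h, ec, Nat.div_add_mod]

lemma bb_lt (x : ZMod M) : bb x < 2 := by
  rw [bb, Nat.div_lt_iff_lt_mul (NeZero.pos M)]
  have := ZMod.val_lt x
  omega

lemma ec_lt (σ x : ZMod M) : ec σ x < 2 := by
  rw [ec, Nat.div_lt_iff_lt_mul (NeZero.pos M)]
  have := ZMod.val_lt x
  have := ZMod.val_lt ((3 * σ + 3) * x)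
  omega

lemma qq_lt (σ x : ZMod M) : qq σ x < 4 := by
  rw [qq, Nat.div_lt_iff_lt_mul (NeZero.pos M)]
  have := ZMod.val_lt x
  have := ZMod.val_lt (σ * x)
  have := ZMod.val_lt (2 * x)
  have := ZMod.val_lt (2 * (σ * x))
  omega

lemma rel_q (σ x : ZMod M) :
    bb x + bb (σ * x) + bb (2 * x) + bb (2 * (σ * x)) + qq σ (2 * x) =
      bb ((3 * σ + 3) * x) + 2 * qq σ x := by
  have h1 := bb_spec x
  have h2 := bb_spec (σ * x)
  have h3 := bb_spec (2 * x)
  have h4 := bb_spec (2 * (σ * x))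
  have h5 := bb_spec ((3 * σ + 3) * x)
  have h6 := qq_spec σ x
  have h7 := qq_spec σ (2 * x)
  rw [show σ * (2 * x) = 2 * (σ * x) by ring,
    show (3 * σ + 3) * (2 * x) = 2 * ((3 * σ + 3) * x) by ring] at h7
  apply Nat.eq_of_mul_eq_mul_left (NeZero.pos M)
  rw [Nat.mul_add, Nat.mul_add, Nat.mul_add, Nat.mul_add, Nat.mul_add, Nat.mul_left_comm]
  omega

lemma rel_e (σ x : ZMod M) :
    bb x + bb ((3 * σ + 3) * x) + ec σ (2 * x) = bb ((3 * σ + 4) * x) + 2 * ec σ x := by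
  have h1 := bb_spec x
  have h4 := bb_spec ((3 * σ + 4) * x)
  have h5 := bb_spec ((3 * σ + 3) * x)
  have h6 := ec_spec σ x
  have h7 := ec_spec σ (2 * x)
  rw [show (3 * σ + 4) * (2 * x) = 2 * ((3 * σ + 4) * x) by ring,
    show (3 * σ + 3) * (2 * x) = 2 * ((3 * σ + 3) * x) by ring] at h7
  apply Nat.eq_of_mul_eq_mul_left (NeZero.pos M)
  rw [Nat.mul_add, Nat.mul_add, Nat.mul_add, Nat.mul_left_comm]
  omega

/-- The state attached to a residue. -/
def SS (σ x : ZMod M) : St :=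
  (bb x, bb (σ * x), bb (2 * x), qq σ x, qq σ (σ * x), ec σ x, ec σ (σ * x))

lemma step_SS (σ x : ZMod M) (hσ : σ * σ = 2) : step (SS σ (σ * x)) (bb x) = SS σ x := by
  have h1 := rel_q σ x
  have h2 := rel_e σ x
  have b1 := bb_lt ((3 * σ + 3) * x)
  have b2 := bb_lt ((3 * σ + 4) * x)
  have hs : σ * (σ * x) = 2 * x := by rw [← mul_assoc, hσ]
  simp only [SS, step, hs]
  have e1 : (bb x + bb (σ * x) + bb (2 * x) + bb (2 * (σ * x)) + qq σ (2 * x)) % 2 =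
    bb ((3 * σ + 3) * x) := by omega
  have e2 : (bb x + bb (σ * x) + bb (2 * x) + bb (2 * (σ * x)) + qq σ (2 * x)) / 2 =
    qq σ x := by omega
  have e3 : (bb x + bb ((3 * σ + 3) * x) + ec σ (2 * x)) / 2 = ec σ x := by omega
  rw [e1, e2, e3]

/-- Horner sums of the top bits. -/
def HH (x : ZMod M) : ℕ → ℕ
  | 0 => 0
  | n + 1 => 2 * HH x n + bb (2 ^ n * x)

lemma HH_spec (x : ZMod M) (n : ℕ) : 2 ^ n * x.val = M * HH x n + (2 ^ n * x).val := by
  induction n with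
  | zero => simp [HH]
  | succ n ih =>
    have h := bb_spec (2 ^ n * x)
    rw [HH, pow_succ', mul_assoc, ih, pow_succ', mul_assoc, Nat.mul_add, Nat.mul_add,
      Nat.mul_left_comm, h]
    ring

lemma two_pow_d {d : ℕ} (hM : M + 1 = 2 ^ d) : (2 : ZMod M) ^ d = 1 := by
  have : ((2 ^ d : ℕ) : ZMod M) = 1 := by rw [← hM]; simp
  simpa using this

lemma val_eq_HH {d : ℕ} (hM : M + 1 = 2 ^ d) (x : ZMod M) : x.val = HH x d := by
  have h := HH_spec x d
  rw [two_pow_d hM, one_mul, ← hM, Nat.add_mul, one_mul] at h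
  exact Nat.eq_of_mul_eq_mul_left (NeZero.pos M) (by omega)

lemma count_digits (n t : ℕ) (ht : t < 2) :
    (Nat.digits 2 (2 * n + t)).count 1 = (Nat.digits 2 n).count 1 + t := by
  rcases Nat.eq_zero_or_pos (2 * n + t) with h | h
  · obtain ⟨rfl, rfl⟩ : n = 0 ∧ t = 0 := by omega
    simp
  · rw [Nat.digits_def' (by norm_num) h]
    have h1 : (2 * n + t) % 2 = t := by omega
    have h2 : (2 * n + t) / 2 = n := by omega
    rw [h1, h2, List.count_cons]
    interval_cases t <;> simp

lemma count_HH (x : ZMod M) (n : ℕ) :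
    (Nat.digits 2 (HH x n)).count 1 = ∑ i ∈ Finset.range n, bb (2 ^ i * x) := by
  induction n with
  | zero => simp [HH]
  | succ n ih => rw [HH, count_digits _ _ (bb_lt _), ih, Finset.sum_range_succ]

lemma sBin_eq {d : ℕ} (hM : M + 1 = 2 ^ d) (a : ℕ) :
    sBin d a = ∑ i ∈ Finset.range d, bb (2 ^ i * (a : ZMod M)) := by
  have h : 2 ^ d - 1 = M := by omega
  rw [sBin, h, ← ZMod.val_natCast, val_eq_HH hM, count_HH]

lemma sum_shift (f : ZMod M → ℕ) {d : ℕ} (hM : M + 1 = 2 ^ d) (x : ZMod M) :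
    ∑ i ∈ Finset.range d, f (2 ^ i * (2 * x)) = ∑ i ∈ Finset.range d, f (2 ^ i * x) := by
  have h1 := Finset.sum_range_succ (fun i => f (2 ^ i * x)) d
  have h2 := Finset.sum_range_succ' (fun i => f (2 ^ i * x)) d
  rw [two_pow_d hM] at h1
  rw [pow_zero] at h2
  have h3 : ∀ i : ℕ, (2 : ZMod M) ^ i * (2 * x) = 2 ^ (i + 1) * x := by intro i; ring
  simp only [h3]
  omega

/-- Total number of carries. -/
def EE (σ : ZMod M) (d : ℕ) (x : ZMod M) : ℕ := ∑ i ∈ Finset.range d, ec σ (2 ^ i * x)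

lemma sum_EE {d : ℕ} (hM : M + 1 = 2 ^ d) (σ x : ZMod M) :
    ∑ i ∈ Finset.range d, bb (2 ^ i * x) + ∑ i ∈ Finset.range d, bb (2 ^ i * ((3 * σ + 3) * x)) =
    ∑ i ∈ Finset.range d, bb (2 ^ i * ((3 * σ + 4) * x)) + EE σ d x := by
  have h : ∀ i ∈ Finset.range d, bb (2 ^ i * x) + bb (2 ^ i * ((3 * σ + 3) * x)) +
      ec σ (2 ^ i * (2 * x)) = bb (2 ^ i * ((3 * σ + 4) * x)) + 2 * ec σ (2 ^ i * x) := by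
    intro i _
    have := rel_e σ (2 ^ i * x)
    rw [show (3 * σ + 3) * (2 ^ i * x) = 2 ^ i * ((3 * σ + 3) * x) by ring,
      show (3 * σ + 4) * (2 ^ i * x) = 2 ^ i * ((3 * σ + 4) * x) by ring,
      show 2 * (2 ^ i * x) = 2 ^ i * (2 * x) by ring] at this
    exact this
  have h2 := Finset.sum_congr rfl h
  rw [Finset.sum_add_distrib, Finset.sum_add_distrib, Finset.sum_add_distrib,
    sum_shift (ec σ) hM, ← Finset.mul_sum] at h2
  unfold EE
  omega

lemma ec_zero (σ : ZMod M) : ec σ 0 = 0 := by simp [ec]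

lemma EE_zero (σ : ZMod M) (d : ℕ) : EE σ d 0 = 0 := by simp [EE, ec_zero]

lemma EE_pow {d : ℕ} (hM : M + 1 = 2 ^ d) (σ x : ZMod M) (i : ℕ) :
    EE σ d (2 ^ i * x) = EE σ d x := by
  induction i with
  | zero => simp
  | succ i ih =>
    rw [pow_succ', mul_assoc, ← ih]
    exact sum_shift (ec σ) hM _

/-- The residues with exactly one carry, located at position `0`. -/
def X0 (σ : ZMod M) (d : ℕ) : Finset (ZMod M) :=
  Finset.univ.filter (fun x => EE σ d x = 1 ∧ ec σ x = 1)

lemma card_EE {d : ℕ} (hM : M + 1 = 2 ^ d) (σ : ZMod M) :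
    (Finset.univ.filter (fun x : ZMod M => EE σ d x = 1)).card = d * (X0 σ d).card := by
  set A := Finset.univ.filter (fun x : ZMod M => EE σ d x = 1) with hA
  have h1 : A.card = ∑ x ∈ A, ∑ i ∈ Finset.range d, ec σ (2 ^ i * x) := by
    rw [Finset.card_eq_sum_ones]
    apply Finset.sum_congr rfl
    intro x hx
    rw [hA, Finset.mem_filter] at hx
    exact hx.2.symm
  rw [h1, Finset.sum_comm]
  have h2 : ∀ i ∈ Finset.range d, ∑ x ∈ A, ec σ (2 ^ i * x) = (X0 σ d).card := by
    intro i hi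
    have hid : i < d := Finset.mem_range.mp hi
    have hinv : (2 : ZMod M) ^ (d - i) * 2 ^ i = 1 := by
      rw [← pow_add, Nat.sub_add_cancel hid.le, two_pow_d hM]
    have h3 : ∑ x ∈ A, ec σ (2 ^ i * x) = ∑ x ∈ A, ec σ x := by
      refine Finset.sum_bij' (fun x _ => 2 ^ i * x) (fun x _ => 2 ^ (d - i) * x) ?_ ?_ ?_ ?_ ?_
      · intro x hx
        rw [hA, Finset.mem_filter] at hx ⊢
        exact ⟨Finset.mem_univ _, by rw [EE_pow hM]; exact hx.2⟩
      · intro x hx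
        rw [hA, Finset.mem_filter] at hx ⊢
        exact ⟨Finset.mem_univ _, by rw [EE_pow hM]; exact hx.2⟩
      · intro x _
        rw [← mul_assoc, hinv, one_mul]
      · intro x _
        rw [← mul_assoc, mul_comm (2 ^ i), hinv, one_mul]
      · intro x _
        rfl
    have h4 : X0 σ d = A.filter (fun x => ec σ x = 1) := by
      rw [X0, hA, Finset.filter_filter]
    rw [h3, h4, Finset.card_filter]
    apply Finset.sum_congr rfl
    intro x _
    have := ec_lt σ x
    split_ifs <;> omega
  rw [Finset.sum_congr rfl h2]
  simp

lemma B_eq {d h : ℕ} (hM : M + 1 = 2 ^ d) :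
    B (3 * 2 ^ h + 4) d = d * (X0 ((2 : ZMod M) ^ h) d).card := by
  rw [← card_EE hM, B]
  have hMd : 2 ^ d - 1 = M := by omega
  rw [hMd]
  have hcond : ∀ a : ℕ, (sBin d a + sBin d ((3 * 2 ^ h + 4 - 1) * a) =
      sBin d ((3 * 2 ^ h + 4) * a) + 1) ↔ EE ((2 : ZMod M) ^ h) d (a : ZMod M) = 1 := by
    intro a
    rw [sBin_eq hM, sBin_eq hM, sBin_eq hM]
    have := sum_EE hM ((2 : ZMod M) ^ h) (a : ZMod M)
    rw [show 3 * 2 ^ h + 4 - 1 = 3 * 2 ^ h + 3 by omega]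
    push_cast
    omega
  simp only [hcond]
  refine Finset.card_bij' (fun (a : ℕ) _ => (a : ZMod M)) (fun (x : ZMod M) _ => x.val) ?_ ?_ ?_ ?_
  · intro a ha
    rw [Finset.mem_filter] at ha ⊢
    exact ⟨Finset.mem_univ _, ha.2⟩
  · intro x hx
    rw [Finset.mem_filter] at hx
    rw [Finset.mem_filter, Finset.mem_Ioo, ZMod.natCast_zmod_val]
    refine ⟨⟨?_, ZMod.val_lt x⟩, hx.2⟩
    rw [Nat.pos_iff_ne_zero, ne_eq, ZMod.val_eq_zero]
    rintro rfl
    rw [EE_zero] at hx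
    exact absurd hx.2 (by norm_num)
  · intro a ha
    rw [Finset.mem_filter, Finset.mem_Ioo] at ha
    exact ZMod.val_cast_of_lt ha.1.2
  · intro x _
    exact ZMod.natCast_zmod_val x

end Arith


section Surj

lemma range_lemma (M d : ℕ) (hM : M + 1 = 2 ^ d) (hMpos : 0 < M) (u t : ℕ → ℤ)
    (hu : ∀ i, 2 * u (i + 2) = u i + M * t i) (ht : ∀ i, 0 ≤ t i ∧ t i ≤ 1)
    (hper : ∀ i, u (i + d) = u i) (i : ℕ) : 0 ≤ u i ∧ u i ≤ M := by
  have hMz : (M : ℤ) + 1 = 2 ^ d := by exact_mod_cast hM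
  have hMp : (0 : ℤ) < M := by exact_mod_cast hMpos
  have h1 : ∀ m, u i ≤ 2 ^ m * u (i + 2 * m) := by
    intro m
    induction m with
    | zero => simp
    | succ m ih =>
      have h := hu (i + 2 * m)
      have h' : 0 ≤ (M : ℤ) * t (i + 2 * m) := mul_nonneg hMp.le (ht _).1
      have : u (i + 2 * m) ≤ 2 * u (i + 2 * (m + 1)) := by
        rw [show i + 2 * (m + 1) = i + 2 * m + 2 by ring]; omega
      calc u i ≤ 2 ^ m * u (i + 2 * m) := ih
        _ ≤ 2 ^ m * (2 * u (i + 2 * (m + 1))) := by gcongr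
        _ = _ := by ring
  have h2 : ∀ m, 2 ^ m * (u (i + 2 * m) - M) ≤ u i - M := by
    intro m
    induction m with
    | zero => simp
    | succ m ih =>
      have h := hu (i + 2 * m)
      have h' : (M : ℤ) * t (i + 2 * m) ≤ M * 1 := by
        apply mul_le_mul_of_nonneg_left (ht _).2 hMp.le
      have : 2 * (u (i + 2 * (m + 1)) - M) ≤ u (i + 2 * m) - M := by
        rw [show i + 2 * (m + 1) = i + 2 * m + 2 by ring]; omega
      calc 2 ^ (m + 1) * (u (i + 2 * (m + 1)) - M)
          = 2 ^ m * (2 * (u (i + 2 * (m + 1)) - M)) := by ring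
        _ ≤ 2 ^ m * (u (i + 2 * m) - M) := by gcongr
        _ ≤ _ := ih
  have e : u (i + 2 * d) = u i := by
    rw [show i + 2 * d = i + d + d by ring, hper, hper]
  have a1 := h1 d
  have a2 := h2 d
  rw [e, ← hMz] at a1 a2
  constructor <;> nlinarith

lemma val_of {M : ℕ} [NeZero M] (u : ℤ) (v : ZMod M) (h0 : 0 ≤ u ∧ u ≤ M)
    (hv : (u : ZMod M) = v) (hne : v ≠ 0) : (v.val : ℤ) = u := by
  have h : u ≠ M := by
    rintro rfl
    apply hne
    rw [← hv]; simp
  rw [← hv, ZMod.val_intCast]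
  exact Int.emod_eq_of_lt h0.1 (lt_of_le_of_ne h0.2 h)

variable {M : ℕ} [NeZero M]

lemma surj_core {d g : ℕ} (hd : d = 2 * g + 1) (hg : 1 ≤ g) (hM : M + 1 = 2 ^ d)
    (b q e y z : ℕ → ℕ) (pb : ∀ i, b (i + d) = b i) (pq : ∀ i, q (i + d) = q i)
    (pe : ∀ i, e (i + d) = e i) (hb : ∀ i, b i ≤ 1) (hy : ∀ i, y i ≤ 1) (hz : ∀ i, z i ≤ 1)
    (hq : ∀ i, q i ≤ 3)
    (R2 : ∀ i, b (i + 3) + b (i + 2) + b (i + 1) + b i + q (i + 1) = y i + 2 * q (i + 3))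
    (R3 : ∀ i, b (i + 3) + y i + e (i + 1) = z i + 2 * e (i + 3))
    (e0 : e 0 = 1) (e1 : e 1 = 0) :
    ∃ X : ℕ → ZMod M, (∀ i, X (i + d) = X i) ∧ (∀ i, (2 : ZMod M) ^ (g + 1) * X (i + 1) = X i) ∧
      ∀ i, bb (X i) = b i ∧ qq ((2 : ZMod M) ^ (g + 1)) (X i) = q i ∧
        ec ((2 : ZMod M) ^ (g + 1)) (X i) = e i := by
  have hMz : (M : ℤ) + 1 = 2 ^ d := by exact_mod_cast hM
  have hMpos : 0 < M := NeZero.pos M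
  have hMp : (0 : ℤ) < M := by exact_mod_cast hMpos
  -- the integer sequences
  obtain ⟨n, hn⟩ : ∃ n : ℕ → ℤ, ∀ i, n i = ∑ l ∈ Finset.range d, 2 ^ l * (b (i + 2 + 2 * l) : ℤ) :=
    ⟨_, fun _ => rfl⟩
  have pn : ∀ i, n (i + d) = n i := by
    intro i
    rw [hn, hn]
    apply Finset.sum_congr rfl
    intro l _
    rw [show i + d + 2 + 2 * l = i + 2 + 2 * l + d by ring, pb]
  have rn : ∀ i, 2 * n (i + 2) = n i + M * (b (i + 2) : ℤ) := by
    intro i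
    have h1 := Finset.sum_range_succ (fun l => 2 ^ l * (b (i + 2 + 2 * l) : ℤ)) d
    have h2 := Finset.sum_range_succ' (fun l => 2 ^ l * (b (i + 2 + 2 * l) : ℤ)) d
    have h3 : 2 * n (i + 2) =
        ∑ l ∈ Finset.range d, 2 ^ (l + 1) * (b (i + 2 + 2 * (l + 1)) : ℤ) := by
      rw [hn, Finset.mul_sum]
      apply Finset.sum_congr rfl
      intro l _
      rw [show i + 2 + 2 * (l + 1) = i + 2 + 2 + 2 * l by ring]
      ring
    have h4 : b (i + 2 + 2 * d) = b (i + 2) := by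
      rw [show i + 2 + 2 * d = i + 2 + d + d by ring, pb, pb]
    rw [h4, ← hMz] at h1
    rw [h3, hn]
    simp only [pow_zero, Nat.mul_zero, Nat.add_zero, one_mul] at h2
    linarith
  obtain ⟨R, hR⟩ : ∃ R : ℕ → ℤ, ∀ i, R i = n (i + 3) + n (i + 2) + n (i + 1) + n i - M * q (i + 3) :=
    ⟨_, fun _ => rfl⟩
  have hR2 : ∀ i, (b (i + 3) : ℤ) + b (i + 2) + b (i + 1) + b i + q (i + 1) = y i + 2 * q (i + 3) :=
    fun i => by exact_mod_cast R2 i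
  have hR3 : ∀ i, (b (i + 3) : ℤ) + y i + e (i + 1) = z i + 2 * e (i + 3) :=
    fun i => by exact_mod_cast R3 i
  have pR : ∀ i, R (i + d) = R i := by
    intro i
    rw [hR, hR, show i + d + 3 = i + 3 + d by ring, show i + d + 2 = i + 2 + d by ring,
      show i + d + 1 = i + 1 + d by ring, pn, pn, pn, pn, pq]
  have rR : ∀ i, 2 * R (i + 2) = R i + M * (y (i + 2) : ℤ) := by
    intro i
    rw [hR, hR]
    have a0 := rn i
    have a1 := rn (i + 1)
    have a2 := rn (i + 2)
    have a3 := rn (i + 3)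
    have a4 := hR2 (i + 2)
    simp only [Nat.add_assoc, Nat.reduceAdd] at a0 a1 a2 a3 a4 ⊢
    linear_combination a0 + a1 + a2 + a3 + (M : ℤ) * a4
  obtain ⟨Z, hZ⟩ : ∃ Z : ℕ → ℤ, ∀ i, Z i = n (i + 3) + R i - M * e (i + 3) :=
    ⟨_, fun _ => rfl⟩
  have pZ : ∀ i, Z (i + d) = Z i := by
    intro i
    rw [hZ, hZ, show i + d + 3 = i + 3 + d by ring, pn, pR, pe]
  have rZ : ∀ i, 2 * Z (i + 2) = Z i + M * (z (i + 2) : ℤ) := by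
    intro i
    rw [hZ, hZ]
    have a3 := rn (i + 3)
    have a4 := hR3 (i + 2)
    have a5 := rR i
    simp only [Nat.add_assoc, Nat.reduceAdd] at a3 a4 a5 ⊢
    linear_combination a3 + a5 + (M : ℤ) * a4
  have bn := range_lemma M d hM hMpos n (fun i => (b (i + 2) : ℤ)) rn
    (fun i => ⟨by positivity, by exact_mod_cast hb _⟩) pn
  have bR := range_lemma M d hM hMpos R (fun i => (y (i + 2) : ℤ)) rR
    (fun i => ⟨by positivity, by exact_mod_cast hy _⟩) pR
  have bZ := range_lemma M d hM hMpos Z (fun i => (z (i + 2) : ℤ)) rZ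
    (fun i => ⟨by positivity, by exact_mod_cast hz _⟩) pZ
  -- the residues
  obtain ⟨X, hX⟩ : ∃ X : ℕ → ZMod M, ∀ i, X i = (n i : ZMod M) := ⟨_, fun _ => rfl⟩
  have pX : ∀ i, X (i + d) = X i := by intro i; rw [hX, hX, pn]
  have X2 : ∀ i, 2 * X (i + 2) = X i := by
    intro i
    have := congrArg (fun k : ℤ => (k : ZMod M)) (rn i)
    simp only [Int.cast_mul, Int.cast_add, Int.cast_ofNat, Int.cast_natCast,
      ZMod.natCast_self, zero_mul, add_zero] at this
    rw [hX, hX, this]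
  have X2m : ∀ m i, 2 ^ m * X (i + 2 * m) = X i := by
    intro m
    induction m with
    | zero => intro i; simp
    | succ m ih =>
      intro i
      rw [pow_succ, mul_assoc, show i + 2 * (m + 1) = i + 2 * m + 2 by ring, X2, ih]
  have Xs : ∀ i, (2 : ZMod M) ^ (g + 1) * X (i + 1) = X i := by
    intro i
    have := X2m (g + 1) i
    rwa [show i + 2 * (g + 1) = i + 1 + d by omega, pX] at this
  have hss : (2 : ZMod M) ^ (g + 1) * 2 ^ (g + 1) = 2 := by
    rw [← pow_add, show g + 1 + (g + 1) = d + 1 by omega, pow_succ, two_pow_d hM, one_mul]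
  -- nonvanishing
  have Xne : ∀ i, X i ≠ 0 := by
    intro i0 hi0
    have all0 : ∀ i, X i = 0 := by
      have up : ∀ m, X (i0 + m) = 0 := by
        intro m
        induction m with
        | zero => exact hi0
        | succ m ih =>
          have h := Xs (i0 + m)
          rw [ih] at h
          have h2 : (2 : ZMod M) ^ g * ((2 : ZMod M) ^ (g + 1) * X (i0 + m + 1)) = 0 := by
            rw [h, mul_zero]
          rwa [← mul_assoc, ← pow_add, show g + (g + 1) = d by omega, two_pow_d hM, one_mul] at h2
      have pXm : ∀ m i, X (i + d * m) = X i := by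
        intro m
        induction m with
        | zero => intro i; simp
        | succ m ih => intro i; rw [Nat.mul_succ, ← Nat.add_assoc, pX, ih]
      intro i
      have h := up (i + d * i0 - i0)
      have : i0 ≤ d * i0 := Nat.le_mul_of_pos_left _ (by omega)
      rwa [show i0 + (i + d * i0 - i0) = i + d * i0 by omega, pXm] at h
    have n0M : ∀ i, n i = 0 ∨ n i = M := by
      intro i
      have h := all0 i
      rw [hX, ZMod.intCast_zmod_eq_zero_iff_dvd] at h
      obtain ⟨c, hc⟩ := h
      have := bn i
      rw [hc] at this ⊢
      have c0 : 0 ≤ c := by nlinarith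
      have c1 : c ≤ 1 := by nlinarith
      have : c = 0 ∨ c = 1 := by omega
      rcases this with rfl | rfl <;> simp
    have nst2 : ∀ i, n (i + 2) = n i := by
      intro i
      have h := rn i
      have hb' := hb (i + 2)
      have hb'' : b (i + 2) = 0 ∨ b (i + 2) = 1 := by omega
      rcases n0M i with h1 | h1 <;> rcases n0M (i + 2) with h2 | h2 <;>
        rcases hb'' with h3 | h3 <;> simp only [h1, h2, h3] at h ⊢ <;> push_cast at h <;>
        exfalso <;> omega
    have nst : ∀ i, n (i + 1) = n i := by
      intro i
      have : ∀ m, n (i + 2 * m) = n i := by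
        intro m
        induction m with
        | zero => rfl
        | succ m ih => rw [show i + 2 * (m + 1) = i + 2 * m + 2 by ring, nst2, ih]
      have h := this (g + 1)
      rwa [show i + 2 * (g + 1) = i + 1 + d by omega, pn] at h
    have nall : ∀ i, n i = n 0 := by
      intro i
      induction i with
      | zero => rfl
      | succ i ih => rw [nst, ih]
    rcases n0M 0 with h0 | h0
    · have z1 := (bZ (d - 3)).1
      have ed := pe 0
      rw [Nat.zero_add, e0] at ed
      rw [hZ, hR, show d - 3 + 3 = d by omega, ed, nall, nall (d - 3 + 2), nall (d - 3 + 1),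
        nall (d - 3), h0] at z1
      have : 0 ≤ (M : ℤ) * q d := by positivity
      push_cast at z1
      linarith
    · have z1 := (bZ (d - 2)).2
      have ed := pe 1
      rw [e1, Nat.add_comm] at ed
      rw [hZ, hR, show d - 2 + 3 = d + 1 by omega, ed, nall, nall (d - 2 + 2), nall (d - 2 + 1),
        nall (d - 2), h0] at z1
      have : (M : ℤ) * q (d + 1) ≤ M * 3 := by
        apply mul_le_mul_of_nonneg_left _ hMp.le
        exact_mod_cast hq _
      push_cast at z1
      linarith
  have unit3 : ∃ c : ZMod M, c * 3 = 1 := by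
    have h3 : M % 3 = 1 := by
      have : 2 ^ d % 3 = 2 := by
        rw [hd, pow_succ, pow_mul, Nat.mul_mod, Nat.pow_mod]
        norm_num
      omega
    refine ⟨-((M / 3 : ℕ) : ZMod M), ?_⟩
    have h4 : ((3 * (M / 3) + 1 : ℕ) : ZMod M) = 0 := by
      rw [show 3 * (M / 3) + 1 = M by omega]; simp
    push_cast at h4
    linear_combination -h4
  have k1ne : ∀ i, (3 * (2 : ZMod M) ^ (g + 1) + 3) * X i ≠ 0 := by
    intro i h
    obtain ⟨c, hc⟩ := unit3
    apply Xne i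
    linear_combination c * (2 ^ (g + 1) - 1) * h - (X i) * (2 ^ (g + 1) * 2 ^ (g + 1) - 1) * hc
      - X i * hss
  have kne : ∀ i, (3 * (2 : ZMod M) ^ (g + 1) + 4) * X i ≠ 0 := by
    intro i h
    apply Xne i
    have h2 : (2 : ZMod M) * X i = 0 := by
      linear_combination (3 * 2 ^ (g + 1) - 4) * h - 9 * X i * hss
    have h3 : (2 : ZMod M) ^ (2 * g) * (2 * X i) = 0 := by rw [h2, mul_zero]
    rwa [← mul_assoc, ← pow_succ, ← hd, two_pow_d hM, one_mul] at h3
  have vX : ∀ i, ((X i).val : ℤ) = n i := fun i => val_of _ _ (bn i) (hX i).symm (Xne i)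
  have s1 : ∀ i, (2 : ZMod M) ^ (g + 1) * X (i + 3) = X (i + 2) := fun i => Xs (i + 2)
  have s2 : ∀ i, (2 : ZMod M) * X (i + 3) = X (i + 1) := fun i => X2 (i + 1)
  have s3 : ∀ i, (2 : ZMod M) * X (i + 2) = X i := X2
  have eR : ∀ i, (R i : ZMod M) = (3 * (2 : ZMod M) ^ (g + 1) + 3) * X (i + 3) := by
    intro i
    rw [hR]
    push_cast
    rw [← hX, ← hX, ← hX, ← hX, ZMod.natCast_self, ← s3 i, ← s2 i, ← s1 i]
    ring
  have vR : ∀ i, (((3 * (2 : ZMod M) ^ (g + 1) + 3) * X (i + 3)).val : ℤ) = R i :=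
    fun i => val_of _ _ (bR i) (eR i) (k1ne _)
  have eZ : ∀ i, (Z i : ZMod M) = (3 * (2 : ZMod M) ^ (g + 1) + 4) * X (i + 3) := by
    intro i
    rw [hZ]
    push_cast
    rw [← hX, eR, ZMod.natCast_self]
    ring
  have vZ : ∀ i, (((3 * (2 : ZMod M) ^ (g + 1) + 4) * X (i + 3)).val : ℤ) = Z i :=
    fun i => val_of _ _ (bZ i) (eZ i) (kne _)
  have main3 : ∀ i, bb (X (i + 3)) = b (i + 3) ∧
      qq ((2 : ZMod M) ^ (g + 1)) (X (i + 3)) = q (i + 3) ∧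
        ec ((2 : ZMod M) ^ (g + 1)) (X (i + 3)) = e (i + 3) := by
    intro i
    refine ⟨?_, ?_, ?_⟩
    · have h := bb_spec (X (i + 3))
      rw [s2] at h
      zify at h ⊢
      rw [vX, vX] at h
      apply mul_left_cancel₀ hMp.ne'
      have := rn (i + 1)
      rw [show i + 1 + 2 = i + 3 by ring] at this
      linarith
    · have h := qq_spec ((2 : ZMod M) ^ (g + 1)) (X (i + 3))
      rw [s2, s1, s3] at h
      zify at h ⊢
      rw [vX, vX, vX, vX, vR, hR] at h
      apply mul_left_cancel₀ hMp.ne'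
      linarith
    · have h := ec_spec ((2 : ZMod M) ^ (g + 1)) (X (i + 3))
      zify at h ⊢
      rw [vX, vR, vZ, hZ] at h
      apply mul_left_cancel₀ hMp.ne'
      linarith
  refine ⟨X, pX, Xs, ?_⟩
  intro i
  have h := main3 (i + d - 3)
  rwa [show i + d - 3 + 3 = i + d by omega, pX, pb, pq, pe] at h

end Surj


section Bij
variable {M : ℕ} [NeZero M]

lemma tau_facts {d g : ℕ} (hd : d = 2 * g + 1) (hg : 1 ≤ g) (hM : M + 1 = 2 ^ d) :
    (2 : ZMod M) ^ (g + 1) * 2 ^ (g + 1) = 2 ∧ (2 : ZMod M) ^ (g + 1) * 2 ^ g = 1 ∧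
    ((2 : ZMod M) ^ g) ^ d = 1 ∧ ((2 : ZMod M) ^ g) ^ (d - 1) = 2 ^ (g + 1) ∧
    ((2 : ZMod M) ^ g) ^ (d - 2) = 2 := by
  have h2 : (2 : ZMod M) ^ d = 1 := two_pow_d hM
  have hst : (2 : ZMod M) ^ (g + 1) * 2 ^ g = 1 := by
    rw [← pow_add, show g + 1 + g = d by omega, h2]
  have hss : (2 : ZMod M) ^ (g + 1) * 2 ^ (g + 1) = 2 := by
    rw [← pow_add, show g + 1 + (g + 1) = d + 1 by omega, pow_succ, h2, one_mul]
  have htd : ((2 : ZMod M) ^ g) ^ d = 1 := by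
    rw [← pow_mul, mul_comm, pow_mul, h2, one_pow]
  have h1 : ((2 : ZMod M) ^ g) ^ (d - 1) = 2 ^ (g + 1) := by
    have : ((2 : ZMod M) ^ g) ^ (d - 1) * 2 ^ g = 1 := by
      rw [← pow_succ, show d - 1 + 1 = d by omega, htd]
    calc ((2 : ZMod M) ^ g) ^ (d - 1) = ((2 : ZMod M) ^ g) ^ (d - 1) * (2 ^ (g + 1) * 2 ^ g) := by
          rw [hst, mul_one]
      _ = (((2 : ZMod M) ^ g) ^ (d - 1) * 2 ^ g) * 2 ^ (g + 1) := by ring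
      _ = _ := by rw [this, one_mul]
  refine ⟨hss, hst, htd, h1, ?_⟩
  have : ((2 : ZMod M) ^ g) ^ (d - 2) * 2 ^ g = 2 ^ (g + 1) := by
    rw [← pow_succ, show d - 2 + 1 = d - 1 by omega, h1]
  calc ((2 : ZMod M) ^ g) ^ (d - 2) = ((2 : ZMod M) ^ g) ^ (d - 2) * (2 ^ (g + 1) * 2 ^ g) := by
        rw [hst, mul_one]
    _ = (((2 : ZMod M) ^ g) ^ (d - 2) * 2 ^ g) * 2 ^ (g + 1) := by ring
    _ = _ := by rw [this, hss]

lemma mem_X0 {d g : ℕ} (hd : d = 2 * g + 1) (hg : 1 ≤ g) (hM : M + 1 = 2 ^ d) (σ x : ZMod M) :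
    x ∈ X0 σ d ↔ ec σ x = 1 ∧ ∀ i, 0 < i → i < d → ec σ (((2 : ZMod M) ^ g) ^ i * x) = 0 := by
  obtain ⟨hss, hst, htd, h1, h2⟩ := tau_facts (M := M) hd hg hM
  have h2d : (2 : ZMod M) ^ d = 1 := two_pow_d hM
  have key : x ∈ X0 σ d ↔ ec σ x = 1 ∧ ∀ j, 0 < j → j < d → ec σ ((2 : ZMod M) ^ j * x) = 0 := by
    rw [X0, Finset.mem_filter, EE]
    have hs : ∑ i ∈ Finset.range d, ec σ (2 ^ i * x) =
        ∑ i ∈ Finset.range (d - 1), ec σ (2 ^ (i + 1) * x) + ec σ x := by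
      conv_lhs => rw [show d = d - 1 + 1 by omega]
      rw [Finset.sum_range_succ']
      simp
    rw [hs]
    constructor
    · rintro ⟨-, ha, hb⟩
      refine ⟨hb, fun j hj0 hjd => ?_⟩
      have h0 : ∑ i ∈ Finset.range (d - 1), ec σ (2 ^ (i + 1) * x) = 0 := by omega
      have := (Finset.sum_eq_zero_iff.mp h0) (j - 1) (Finset.mem_range.mpr (by omega))
      rwa [show j - 1 + 1 = j by omega] at this
    · rintro ⟨ha, hb⟩
      refine ⟨Finset.mem_univ _, ?_, ha⟩
      rw [Finset.sum_eq_zero, ha]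
      intro i hi
      rw [Finset.mem_range] at hi
      exact hb _ (by omega) (by omega)
  rw [key]
  have cop1 : Nat.Coprime d g := by
    rw [hd]; simp
  have cop2 : Nat.Coprime d (d - 2) := by
    have hodd : Nat.Coprime d 2 := by
      rw [hd]; simp
    have : Nat.Coprime (d - 2) 2 := by
      rw [Nat.coprime_two_right, Nat.odd_iff]; omega
    have h3 : Nat.Coprime (d - 2 + 2) (d - 2) := by
      rw [Nat.coprime_self_add_left]; exact this.symm
    rwa [show d - 2 + 2 = d by omega] at h3
  have ndvd : ∀ c i, Nat.Coprime d c → 0 < i → i < d → 0 < (c * i) % d ∧ (c * i) % d < d := by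
    intro c i hc h0 hi
    refine ⟨Nat.pos_of_ne_zero fun h => ?_, Nat.mod_lt _ (by omega)⟩
    have := hc.dvd_of_dvd_mul_left (Nat.dvd_of_mod_eq_zero h)
    exact absurd (Nat.le_of_dvd h0 this) (by omega)
  refine and_congr_right fun _ => ⟨fun h i h0 hi => ?_, fun h i h0 hi => ?_⟩
  · rw [← pow_mul, pow_eq_pow_mod _ h2d]
    obtain ⟨ha, hb⟩ := ndvd g i cop1 h0 hi
    exact h _ ha hb
  · have e : (2 : ZMod M) ^ i = ((2 : ZMod M) ^ g) ^ (((d - 2) * i) % d) := by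
      rw [← pow_eq_pow_mod _ htd, pow_mul, h2]
    rw [e]
    obtain ⟨ha, hb⟩ := ndvd (d - 2) i cop2 h0 hi
    exact h _ ha hb

lemma isRun_SS {d g : ℕ} (hd : d = 2 * g + 1) (hg : 1 ≤ g) (hM : M + 1 = 2 ^ d) (x : ZMod M)
    (hx : x ∈ X0 ((2 : ZMod M) ^ (g + 1)) d) :
    SS ((2 : ZMod M) ^ (g + 1)) x ∈ S10 ∧
    IsRun (SS ((2 : ZMod M) ^ (g + 1)) x) (d - 1) (SS ((2 : ZMod M) ^ (g + 1)) x)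
      (fun i => bb (((2 : ZMod M) ^ g) ^ (i + 1) * x))
      (fun i => SS ((2 : ZMod M) ^ (g + 1)) (((2 : ZMod M) ^ g) ^ i * x)) := by
  obtain ⟨hss, hst, htd, h1, h2⟩ := tau_facts (M := M) hd hg hM
  obtain ⟨ha, hb⟩ := (mem_X0 hd hg hM _ x).mp hx
  refine ⟨?_, ?_, ?_, ?_, ?_⟩
  · have h0 := hb (d - 1) (by omega) (by omega)
    rw [h1] at h0
    simp only [SS, S10, Finset.mem_product, Finset.mem_range, Finset.mem_singleton]
    exact ⟨bb_lt _, bb_lt _, bb_lt _, qq_lt _ _, qq_lt _ _, ha, h0⟩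
  · simp
  · simp only [show d - 1 + 1 = d by omega, htd, one_mul]
  · intro i _
    refine ⟨?_, ?_⟩
    · have := bb_lt (((2 : ZMod M) ^ g) ^ (i + 1) * x)
      show bb (((2 : ZMod M) ^ g) ^ (i + 1) * x) = 0 ∨ bb (((2 : ZMod M) ^ g) ^ (i + 1) * x) = 1
      omega
    · have := step_SS ((2 : ZMod M) ^ (g + 1)) (((2 : ZMod M) ^ g) ^ (i + 1) * x) hss
      have e : (2 : ZMod M) ^ (g + 1) * (((2 : ZMod M) ^ g) ^ (i + 1) * x) =
          ((2 : ZMod M) ^ g) ^ i * x := by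
        rw [pow_succ' ((2 : ZMod M) ^ g), ← mul_assoc, ← mul_assoc, hst, one_mul]
      rw [e] at this
      exact this.symm
  · intro i h0 hi
    exact hb i h0 (by omega)

lemma bits_inj {d g : ℕ} (hd : d = 2 * g + 1) (hg : 1 ≤ g) (hM : M + 1 = 2 ^ d) (x y : ZMod M)
    (h : ∀ i < d, bb (((2 : ZMod M) ^ g) ^ (i + 1) * x) = bb (((2 : ZMod M) ^ g) ^ (i + 1) * y)) :
    x = y := by
  obtain ⟨hss, hst, htd, h1, h2⟩ := tau_facts (M := M) hd hg hM
  have hj : ∀ j, bb ((2 : ZMod M) ^ j * x) = bb ((2 : ZMod M) ^ j * y) := by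
    intro j
    have e : (2 : ZMod M) ^ j = ((2 : ZMod M) ^ g) ^ (((d - 2) * j + (d - 1)) % d + 1) := by
      rw [pow_succ, ← pow_eq_pow_mod _ htd, ← pow_succ, add_assoc, show d - 1 + 1 = d by omega,
        pow_add, htd, mul_one, pow_mul, h2]
    rw [e]
    exact h _ (Nat.mod_lt _ (by omega))
  have hH : ∀ n, HH x n = HH y n := by
    intro n
    induction n with
    | zero => rfl
    | succ n ih => rw [HH, HH, ih, hj]
  apply ZMod.val_injective M
  rw [val_eq_HH hM, val_eq_HH hM, hH]

/-- Range condition on the states. -/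
def Okay (s : St) : Prop :=
  s.1 ≤ 1 ∧ s.2.1 ≤ 1 ∧ s.2.2.1 ≤ 1 ∧ s.2.2.2.1 ≤ 3 ∧ s.2.2.2.2.1 ≤ 3

lemma Okay_step (s : St) (b : ℕ) (hs : Okay s) (hb : b = 0 ∨ b = 1) : Okay (step s b) := by
  obtain ⟨b1, b2, b3, q1, q2, e1, e2⟩ := s
  simp only [Okay, step] at *
  omega

lemma surj_run {d g : ℕ} (hd : d = 2 * g + 1) (hg : 1 ≤ g) (hM : M + 1 = 2 ^ d) (T : St)
    (hT : T ∈ S10) (β : ℕ → ℕ) (σ' : ℕ → St) (hr : IsRun T (d - 1) T β σ') :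
    ∃ x ∈ X0 ((2 : ZMod M) ^ (g + 1)) d, SS ((2 : ZMod M) ^ (g + 1)) x = T ∧
      ∀ i < d, bb (((2 : ZMod M) ^ g) ^ (i + 1) * x) = β i := by
  obtain ⟨hss, hst, htd, h1, h2⟩ := tau_facts (M := M) hd hg hM
  obtain ⟨r0, rT, rs, re⟩ := hr
  rw [show d - 1 + 1 = d by omega] at rT
  simp only [S10, Finset.mem_product, Finset.mem_range, Finset.mem_singleton] at hT
  set s : ℕ → St := fun i => σ' (i % d) with hs
  set β' : ℕ → ℕ := fun i => β (i % d) with hβ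
  have hβ01 : ∀ i, β' i = 0 ∨ β' i = 1 := fun i => (rs _ (by
    have := Nat.mod_lt i (show 0 < d by omega); omega)).1
  have hstep : ∀ i, s (i + 1) = step (s i) (β' i) := by
    intro i
    have hlt := Nat.mod_lt i (show 0 < d by omega)
    have h := (rs (i % d) (by omega)).2
    show σ' ((i + 1) % d) = step (σ' (i % d)) (β (i % d))
    rw [← h]
    by_cases hc : i % d + 1 = d
    · have : (i + 1) % d = 0 := by
        rw [Nat.add_mod, ← Nat.mod_add_mod] at *
        simp [hc]
      rw [this, hc, r0, rT]
    · congr 1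
      rw [← Nat.mod_add_mod, Nat.mod_eq_of_lt (by omega)]
  have hper : ∀ i, s (i + d) = s i := fun i => by simp [hs]
  have s0 : s 0 = T := by simp [hs, r0]
  have hok : ∀ i, Okay (s i) := by
    intro i
    induction i with
    | zero => rw [s0]; simp only [Okay]; omega
    | succ i ih => rw [hstep]; exact Okay_step _ _ ih (hβ01 i)
  set b : ℕ → ℕ := fun i => (s i).1 with hb
  set q : ℕ → ℕ := fun i => (s i).2.2.2.1 with hq
  set e : ℕ → ℕ := fun i => ee (s i) with he
  set y : ℕ → ℕ := fun i => (b (i + 3) + b (i + 2) + b (i + 1) + b i + q (i + 1)) % 2 with hy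
  set z : ℕ → ℕ := fun i => (b (i + 3) + y i + e (i + 1)) % 2 with hz
  have st : ∀ i, (s (i + 1)).1 = β' i ∧ (s (i + 1)).2.1 = (s i).1 ∧
      (s (i + 1)).2.2.1 = (s i).2.1 ∧
      (s (i + 1)).2.2.2.1 = (β' i + (s i).1 + (s i).2.1 + (s i).2.2.1 + (s i).2.2.2.2.1) / 2 ∧
      (s (i + 1)).2.2.2.2.1 = (s i).2.2.2.1 ∧
      (s (i + 1)).2.2.2.2.2.1 =
        (β' i + (β' i + (s i).1 + (s i).2.1 + (s i).2.2.1 + (s i).2.2.2.2.1) % 2 +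
          (s i).2.2.2.2.2.2) / 2 ∧
      (s (i + 1)).2.2.2.2.2.2 = (s i).2.2.2.2.2.1 := by
    intro i
    rw [hstep]
    exact ⟨rfl, rfl, rfl, rfl, rfl, rfl, rfl⟩
  have R : ∀ i, q (i + 3) = (b (i + 3) + b (i + 2) + b (i + 1) + b i + q (i + 1)) / 2 ∧
      e (i + 3) = (b (i + 3) + y i + e (i + 1)) / 2 ∧
      s (i + 3) = (b (i + 3), b (i + 2), b (i + 1), q (i + 3), q (i + 2), e (i + 3), e (i + 2)) := by
    intro i
    obtain ⟨a1, a2, a3, a4, a5, a6, a7⟩ := st i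
    obtain ⟨b1, b2, b3, b4, b5, b6, b7⟩ := st (i + 1)
    obtain ⟨c1, c2, c3, c4, c5, c6, c7⟩ := st (i + 2)
    have k1 : β' (i + 2) = b (i + 3) := c1.symm
    have k2 : (s (i + 2)).2.1 = b (i + 1) := b2
    have k3 : (s (i + 2)).2.2.1 = b i := b3.trans a2
    have k4 : (s (i + 2)).2.2.2.2.1 = q (i + 1) := b5
    have k5 : (s (i + 2)).2.2.2.2.2.2 = e (i + 1) := b7
    have k6 : (s (i + 2)).1 = b (i + 2) := rfl
    rw [k1, k2, k3, k4, k6] at c4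
    rw [k1, k2, k3, k4, k5, k6] at c6
    refine ⟨c4, c6, ?_⟩
    have l1 : (s (i + 3)).2.1 = b (i + 2) := c2
    have l2 : (s (i + 3)).2.2.1 = b (i + 1) := c3.trans b2
    have l3 : (s (i + 3)).2.2.2.2.1 = q (i + 2) := c5
    have l4 : (s (i + 3)).2.2.2.2.2.2 = e (i + 2) := c7
    rw [← l1, ← l2, ← l3, ← l4]
    rfl
  obtain ⟨X, pX, sX, fX⟩ := surj_core (M := M) hd hg hM b q e y z
    (fun i => by simp only [hb, hper]) (fun i => by simp only [hq, hper])
    (fun i => by simp only [he, hper]) (fun i => (hok i).1)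
    (fun i => by simp only [hy]; omega) (fun i => by simp only [hz]; omega)
    (fun i => (hok i).2.2.2.1)
    (fun i => by have := (R i).1; simp only [hy]; omega)
    (fun i => by have := (R i).2.1; simp only [hz]; omega)
    (by simp only [he, s0]; exact hT.2.2.2.2.2.1)
    (by
      have := re 1 (by omega) (by omega)
      simp only [he, hs]
      rwa [Nat.mod_eq_of_lt (by omega)])
  have tX : ∀ i, ((2 : ZMod M) ^ g) ^ i * X 0 = X i := by
    intro i
    induction i with
    | zero => simp
    | succ i ih =>
      rw [pow_succ', mul_assoc, ih, ← sX i, ← mul_assoc, mul_comm ((2 : ZMod M) ^ g), hst, one_mul]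
  refine ⟨X 0, ?_, ?_, ?_⟩
  · rw [mem_X0 hd hg hM]
    refine ⟨?_, fun i h0 hi => ?_⟩
    · rw [(fX 0).2.2]
      simp only [he, s0]; exact hT.2.2.2.2.2.1
    · rw [tX, (fX i).2.2]
      simp only [he, hs]
      rw [Nat.mod_eq_of_lt hi]
      exact re i h0 (by omega)
  · have u1 : (2 : ZMod M) ^ (g + 1) * X 0 = X (d - 1) := by rw [← h1, tX]
    have u2 : (2 : ZMod M) * X 0 = X (d - 2) := by rw [← tX (d - 2), h2]
    have u3 : X 0 = X d := by rw [← pX 0, Nat.zero_add]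
    have hRd := (R (d - 3)).2.2
    rw [show d - 3 + 3 = d by omega, show d - 3 + 2 = d - 1 by omega,
      show d - 3 + 1 = d - 2 by omega] at hRd
    have hsd : s d = T := by rw [← s0, ← hper 0, Nat.zero_add]
    rw [hsd] at hRd
    rw [SS, u1, u2, u3, (fX _).1, (fX _).1, (fX _).1, (fX _).2.1, (fX _).2.1, (fX _).2.2,
      (fX _).2.2, hRd]
  · intro i hi
    rw [tX, (fX _).1]
    have := (st i).1
    simp only [hb]
    rw [this]
    simp only [hβ]
    rw [Nat.mod_eq_of_lt hi]

lemma card_X0 {d g : ℕ} (hd : d = 2 * g + 1) (hg : 1 ≤ g) (hM : M + 1 = 2 ^ d) :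
    (X0 ((2 : ZMod M) ^ (g + 1)) d).card = F (d - 1) := by
  have hF : F (d - 1) = (S10.sigma (fun T => Wd T (d - 1) T)).card := by
    rw [Finset.card_sigma, F]
    exact Finset.sum_congr rfl fun T _ => (card_Wd T _ T).symm
  rw [hF]
  refine Finset.card_bij (fun x _ => ⟨SS ((2 : ZMod M) ^ (g + 1)) x,
    (List.range (d - 1 + 1)).map (fun i => bb (((2 : ZMod M) ^ g) ^ (i + 1) * x))⟩) ?_ ?_ ?_
  · intro x hx
    obtain ⟨h1, h2⟩ := isRun_SS hd hg hM x hx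
    rw [Finset.mem_sigma]
    exact ⟨h1, mem_Wd_of_run _ _ _ _ _ h2⟩
  · intro x hx y hy hxy
    have h2 := congrArg (fun p : (_ : St) × List ℕ => p.2) hxy
    simp only [List.map_inj_left, List.mem_range] at h2
    exact bits_inj hd hg hM x y fun i hi => h2 i (by omega)
  · rintro ⟨T, w⟩ hp
    rw [Finset.mem_sigma] at hp
    obtain ⟨β, σ', hw, hr⟩ := run_of_mem_Wd _ _ _ _ hp.2
    obtain ⟨x, hx, hxT, hxb⟩ := surj_run (M := M) hd hg hM T hp.1 β σ' hr
    refine ⟨x, hx, ?_⟩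
    have : (List.range (d - 1 + 1)).map (fun i => bb (((2 : ZMod M) ^ g) ^ (i + 1) * x)) = w := by
      rw [show w = _ from hw, List.map_inj_left]
      intro i hi
      rw [List.mem_range] at hi
      exact hxb i (by omega)
    rw [this, hxT]

end Bij

lemma AGII_eq (g : ℕ) (hg : 1 ≤ g) : AGII (2 * g + 1) = F (2 * g) := by
  have hpow : 1 < 2 ^ (2 * g + 1) := Nat.one_lt_two_pow (by omega)
  have : NeZero (2 ^ (2 * g + 1) - 1) := ⟨by omega⟩
  have hM : 2 ^ (2 * g + 1) - 1 + 1 = 2 ^ (2 * g + 1) := by omega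
  have h1 := B_eq (M := 2 ^ (2 * g + 1) - 1) (d := 2 * g + 1) (h := g + 1) hM
  rw [card_X0 rfl hg hM] at h1
  rw [AGII, show (2 * g + 1 + 1) / 2 = g + 1 by omega, h1]
  have : ((2 * g + 1 : ℕ) : ℚ) ≠ 0 := by positivity
  rw [Nat.cast_mul, mul_div_cancel_left₀ _ this]
  rfl

end GlynnII

/-- The Glynn type (II) quantities `A_{3σ+4}(d)` satisfy the stated initial values and
the five-term recurrence for odd `d ≥ 11`. -/
theorem stmt_10 :
    AGII 3 = 1 ∧ AGII 5 = 1 ∧ AGII 7 = 5 ∧ AGII 9 = 7 ∧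
    ∀ d : ℕ, Odd d → 11 ≤ d →
      AGII d = AGII (d - 2) + 3 * AGII (d - 4) - AGII (d - 6) - AGII (d - 8) + 1 := by
  refine ⟨?_, ?_, ?_, ?_, ?_⟩
  · rw [GlynnII.AGII_eq 1 le_rfl, show 2 * 1 = 2 by rfl, GlynnII.F_two]; norm_num
  · have h : GlynnII.F 4 = 1 := GlynnII.Fc_get 0 (by norm_num)
    rw [GlynnII.AGII_eq 2 (by norm_num), show 2 * 2 = 4 by rfl, h]; norm_num
  · have h : GlynnII.F 6 = 5 := GlynnII.Fc_get 1 (by norm_num)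
    rw [GlynnII.AGII_eq 3 (by norm_num), show 2 * 3 = 6 by rfl, h]; norm_num
  · have h : GlynnII.F 8 = 7 := GlynnII.Fc_get 2 (by norm_num)
    rw [GlynnII.AGII_eq 4 (by norm_num), show 2 * 4 = 8 by rfl, h]; norm_num
  · intro d hodd hd
    obtain ⟨m, rfl⟩ : ∃ m, d = 2 * m + 11 := by
      obtain ⟨k, hk⟩ := hodd
      exact ⟨k - 5, by omega⟩
    have h := GlynnII.F_final m
    rw [show 2 * m + 11 - 2 = 2 * (m + 4) + 1 by omega,
      show 2 * m + 11 - 4 = 2 * (m + 3) + 1 by omega,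
      show 2 * m + 11 - 6 = 2 * (m + 2) + 1 by omega,
      show 2 * m + 11 - 8 = 2 * (m + 1) + 1 by omega,
      show 2 * m + 11 = 2 * (m + 5) + 1 by omega,
      GlynnII.AGII_eq _ (by omega), GlynnII.AGII_eq _ (by omega), GlynnII.AGII_eq _ (by omega),
      GlynnII.AGII_eq _ (by omega), GlynnII.AGII_eq _ (by omega)]
    rw [show 2 * (m + 5) = 2 * m + 10 by ring, show 2 * (m + 4) = 2 * m + 8 by ring,
      show 2 * (m + 3) = 2 * m + 6 by ring, show 2 * (m + 2) = 2 * m + 4 by ring,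
      show 2 * (m + 1) = 2 * m + 2 by ring]
    have hq : (GlynnII.F (2 * m + 10) : ℚ) + GlynnII.F (2 * m + 4) + GlynnII.F (2 * m + 2) =
        GlynnII.F (2 * m + 8) + 3 * GlynnII.F (2 * m + 6) + 1 := by exact_mod_cast h
    linarith
end

section
/- For odd d, let σ = 2^{(d+1)/2}, let γ = 2^{(3d+1)/4} if d ≡ 1 (mod 4) and γ = 2^{(d+1)/4} if d ≡ 3 (mod 4), and let A_{σ+γ}(d) denote the rational number B_{σ+γ}(d)/d. Then A_{σ+γ}(3) = 1, A_{σ+γ}(5) = 1, A_{σ+γ}(7) = 3, A_{σ+γ}(9) = 7, A_{σ+γ}(11) = 13, and for every odd d ≥ 13, A_{σ+γ}(d) = A_{σ+γ}(d−2) + A_{σ+γ}(d−4) + A_{σ+γ}(d−6) + A_{σ+γ}(d−8) − 1. -/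
/-- `γ = 2^{(3d+1)/4}` if `d ≡ 1 (mod 4)`, and `γ = 2^{(d+1)/4}` if `d ≡ 3 (mod 4)`. -/
def gam (d : ℕ) : ℕ := if d % 4 = 1 then 2 ^ ((3 * d + 1) / 4) else 2 ^ ((d + 1) / 4)

/-- `AGI d = B_{σ+γ}(d) / d` where `σ = 2^{(d+1)/2}` (the Glynn type (I) exponent). -/
noncomputable def AGI (d : ℕ) : ℚ := (B (2 ^ ((d + 1) / 2) + gam d) d : ℚ) / d

/-- States of the transfer automaton. -/
abbrev St := Bool × Bool × Bool × Bool × Bool × Bool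

def nxt : St → Bool → St
  | (p, q, f0, f1, f2, f3), a => (q, a, f1, f2, f3, (p && q) || (p && f0) || (q && f0))

def cc : St → Bool
  | (p, q, f0, _, _, _) => xor (xor p q) f0

def ok (k : ℕ) (c a : Bool) : Bool :=
  if k = 0 then a && !c else if k = 4 then !a && c else (!a || c)

def L (k : ℕ) (F : St → ℤ) (s : St) : ℤ :=
  (if ok k (cc s) false then F (nxt s false) else 0) +
  (if ok k (cc s) true then F (nxt s true) else 0)

def Fz (s : St) : ℕ → St → ℤ
  | 0 => fun t => if t = s then 1 else 0
  | n + 1 => L 5 (Fz s n)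

def tot (n : ℕ) : ℤ := ∑ s : St, L 0 (L 1 (L 2 (L 3 (L 4 (Fz s n))))) s

def encS : St → ℕ
  | (p, q, f0, f1, f2, f3) => 32 * p.toNat + 16 * q.toNat + 8 * f0.toNat + 4 * f1.toNat
      + 2 * f2.toNat + f3.toNat

def inU (s : St) : Bool := [0, 1, 2, 3, 4, 6, 8, 9, 10, 11, 12, 14, 15, 16, 18, 20, 22, 24, 28, 30, 32, 33, 35, 36, 39, 40, 41, 44, 45, 47, 48, 49, 51, 52, 56, 57, 60].contains (encS s)
def inQ (s : St) : Bool := [0, 2, 3, 4, 6, 8, 12, 16, 18, 24, 32, 33, 36, 41, 48, 52].contains (encS s)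

theorem tot_vals : tot 0 = 1 ∧ tot 2 = 3 ∧ tot 4 = 7 ∧ tot 6 = 13 ∧ tot 8 = 23 ∧ tot 10 = 45 ∧ tot 12 = 87 := by decide +kernel
theorem tot_odd : tot 1 = 1 ∧ tot 3 = 3 ∧ tot 5 = 6 ∧ tot 7 = 12 ∧ tot 9 = 21 ∧ tot 11 = 41 := by decide +kernel

theorem L_congr {k : ℕ} {F F' : St → ℤ} {s : St}
    (h : ∀ a, ok k (cc s) a = true → F (nxt s a) = F' (nxt s a)) : L k F s = L k F' s := by
  unfold L
  congr 1
  · split_ifs with h1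
    · exact h _ h1
    · rfl
  · split_ifs with h1
    · exact h _ h1
    · rfl

def E5 (F : St → ℤ) (s : St) : ℤ := L 0 (L 1 (L 2 (L 3 (L 4 F)))) s

theorem E5_congr {F F' : St → ℤ} {s : St}
    (h : ∀ a0, ok 0 (cc s) a0 = true → ∀ a1, ok 1 (cc (nxt s a0)) a1 = true →
      ∀ a2, ok 2 (cc (nxt (nxt s a0) a1)) a2 = true →
      ∀ a3, ok 3 (cc (nxt (nxt (nxt s a0) a1) a2)) a3 = true →
      ∀ a4, ok 4 (cc (nxt (nxt (nxt (nxt s a0) a1) a2) a3)) a4 = true →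
      F (nxt (nxt (nxt (nxt (nxt s a0) a1) a2) a3) a4) =
      F' (nxt (nxt (nxt (nxt (nxt s a0) a1) a2) a3) a4)) : E5 F s = E5 F' s := by
  unfold E5
  exact L_congr fun a0 h0 => L_congr fun a1 h1 => L_congr fun a2 h2 => L_congr fun a3 h3 =>
    L_congr fun a4 h4 => h a0 h0 a1 h1 a2 h2 a3 h3 a4 h4

set_option synthInstance.maxSize 4096 in
set_option synthInstance.maxHeartbeats 400000 in
theorem E5_Q : ∀ s : St, inU s = true → 
    ∀ a0, ok 0 (cc s) a0 = true → ∀ a1, ok 1 (cc (nxt s a0)) a1 = true →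
      ∀ a2, ok 2 (cc (nxt (nxt s a0) a1)) a2 = true →
      ∀ a3, ok 3 (cc (nxt (nxt (nxt s a0) a1) a2)) a3 = true →
      ∀ a4, ok 4 (cc (nxt (nxt (nxt (nxt s a0) a1) a2) a3)) a4 = true →
      inQ (nxt (nxt (nxt (nxt (nxt s a0) a1) a2) a3) a4) = true := by decide +kernel

set_option synthInstance.maxSize 4096 in
set_option synthInstance.maxHeartbeats 400000 in
theorem E5_U : ∀ s : St, 
    ∀ a0, ok 0 (cc s) a0 = true → ∀ a1, ok 1 (cc (nxt s a0)) a1 = true →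
      ∀ a2, ok 2 (cc (nxt (nxt s a0) a1)) a2 = true →
      ∀ a3, ok 3 (cc (nxt (nxt (nxt s a0) a1) a2)) a3 = true →
      ∀ a4, ok 4 (cc (nxt (nxt (nxt (nxt s a0) a1) a2) a3)) a4 = true →
      inU (nxt (nxt (nxt (nxt (nxt s a0) a1) a2) a3) a4) = true := by decide +kernel

theorem U_closed : ∀ s : St, inU s = true → ∀ a, ok 5 (cc s) a = true → inU (nxt s a) = true := by
  decide +kernel

theorem L_zero (k : ℕ) : L k (fun _ => 0) = fun _ => 0 := by
  funext s; simp [L]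

theorem E5_zero (s : St) : E5 (fun _ => 0) s = 0 := by
  simp [E5, L_zero]

theorem Fz_U (s : St) (hs : inU s = false) (n : ℕ) : ∀ t, inU t = true → Fz s n t = 0 := by
  induction n with
  | zero =>
    intro t ht
    have : t ≠ s := by rintro rfl; simp [hs] at ht
    simp [Fz, this]
  | succ n ih =>
    intro t ht
    have : L 5 (Fz s n) t = L 5 (fun _ => 0) t := L_congr fun a ha => ih _ (U_closed t ht a ha)
    simp [Fz, this, L_zero]

theorem E5_notU (s : St) (hs : inU s = false) (n : ℕ) : E5 (Fz s n) s = 0 := by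
  rw [← E5_zero s]
  refine E5_congr fun a0 h0 a1 h1 a2 h2 a3 h3 a4 h4 => ?_
  exact Fz_U s hs n _ (E5_U s a0 h0 a1 h1 a2 h2 a3 h3 a4 h4)

def Gz (s : St) (n : ℕ) (t : St) : ℤ :=
  Fz s (n + 8) t - Fz s (n + 6) t - Fz s (n + 4) t - Fz s (n + 2) t - Fz s n t

theorem L_sub (k : ℕ) (F F' : St → ℤ) : L k (fun t => F t - F' t) = fun t => L k F t - L k F' t := by
  funext s; simp only [L]; split_ifs <;> ring

theorem E5_sub (F F' : St → ℤ) (s : St) : E5 (fun t => F t - F' t) s = E5 F s - E5 F' s := by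
  simp [E5, L_sub]

theorem E5_Gz (s : St) (n : ℕ) : E5 (Gz s n) s = E5 (Fz s (n + 8)) s - E5 (Fz s (n + 6)) s
    - E5 (Fz s (n + 4)) s - E5 (Fz s (n + 2)) s - E5 (Fz s n) s := by
  unfold Gz
  simp only [E5_sub]

theorem st0 (s : St) (n : ℕ) : Fz s (n + 1) (false, false, false, false, false, false) =
    Fz s n (false, false, false, false, false, false) := by
  simp [Fz, L, ok, cc, nxt]
theorem st2 (s : St) (n : ℕ) : Fz s (n + 1) (false, false, false, false, true, false) =
    Fz s n (false, false, false, true, false, false) := by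
  simp [Fz, L, ok, cc, nxt]
theorem st3 (s : St) (n : ℕ) : Fz s (n + 1) (false, false, false, false, true, true) =
    Fz s n (false, false, false, true, true, false) := by
  simp [Fz, L, ok, cc, nxt]
theorem st4 (s : St) (n : ℕ) : Fz s (n + 1) (false, false, false, true, false, false) =
    Fz s n (false, false, true, false, false, false) := by
  simp [Fz, L, ok, cc, nxt]
theorem st6 (s : St) (n : ℕ) : Fz s (n + 1) (false, false, false, true, true, false) =
    Fz s n (false, false, true, true, false, false) := by
  simp [Fz, L, ok, cc, nxt]
theorem st8 (s : St) (n : ℕ) : Fz s (n + 1) (false, false, true, false, false, false) =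
    Fz s n (false, false, false, false, false, false) + Fz s n (false, true, false, false, false, false) := by
  simp [Fz, L, ok, cc, nxt]
theorem st12 (s : St) (n : ℕ) : Fz s (n + 1) (false, false, true, true, false, false) =
    Fz s n (false, false, true, false, false, false) + Fz s n (false, true, true, false, false, false) := by
  simp [Fz, L, ok, cc, nxt]
theorem st16 (s : St) (n : ℕ) : Fz s (n + 1) (false, true, false, false, false, false) =
    Fz s n (true, false, false, false, false, false) + Fz s n (true, true, false, false, false, false) := by
  simp [Fz, L, ok, cc, nxt]
theorem st18 (s : St) (n : ℕ) : Fz s (n + 1) (false, true, false, false, true, false) =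
    Fz s n (true, false, false, true, false, false) + Fz s n (true, true, false, true, false, false) := by
  simp [Fz, L, ok, cc, nxt]
theorem st24 (s : St) (n : ℕ) : Fz s (n + 1) (false, true, true, false, false, false) =
    Fz s n (true, false, false, false, false, true) := by
  simp [Fz, L, ok, cc, nxt]
theorem st32 (s : St) (n : ℕ) : Fz s (n + 1) (true, false, false, false, false, false) =
    Fz s n (false, false, false, false, false, false) + Fz s n (false, true, false, false, false, false) := by
  simp [Fz, L, ok, cc, nxt]
theorem st33 (s : St) (n : ℕ) : Fz s (n + 1) (true, false, false, false, false, true) =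
    Fz s n (false, false, false, false, true, false) + Fz s n (false, true, false, false, true, false) := by
  simp [Fz, L, ok, cc, nxt]
theorem st36 (s : St) (n : ℕ) : Fz s (n + 1) (true, false, false, true, false, false) =
    Fz s n (false, false, true, false, false, false) + Fz s n (false, true, true, false, false, false) := by
  simp [Fz, L, ok, cc, nxt]
theorem st41 (s : St) (n : ℕ) : Fz s (n + 1) (true, false, true, false, false, true) =
    Fz s n (false, false, false, false, true, true) := by
  simp [Fz, L, ok, cc, nxt]
theorem st48 (s : St) (n : ℕ) : Fz s (n + 1) (true, true, false, false, false, false) =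
    Fz s n (true, false, false, false, false, true) := by
  simp [Fz, L, ok, cc, nxt]
theorem st52 (s : St) (n : ℕ) : Fz s (n + 1) (true, true, false, true, false, false) =
    Fz s n (true, false, true, false, false, true) := by
  simp [Fz, L, ok, cc, nxt]

def kap (t : St) : ℤ :=
  if [0].contains (encS t) then -3 else
  if [2, 4, 8, 32].contains (encS t) then -1 else
  if [18].contains (encS t) then 4 else
  if [24, 33, 48].contains (encS t) then 3 else 2

def zst : St := (false, false, false, false, false, false)

theorem Gz_Q (s : St) (n : ℕ) (t : St) (ht : inQ t = true) :
    Gz s (n + 5) t = kap t * Fz s n zst := by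
  obtain ⟨p, q, f0, f1, f2, f3⟩ := t
  cases p <;> cases q <;> cases f0 <;> cases f1 <;> cases f2 <;> cases f3 <;>
    first
    | (exfalso; revert ht; decide)
    | (simp only [Gz, Nat.add_assoc, Nat.reduceAdd, st0, st2, st3, st4, st6, st8, st12, st16, st18, st24,
        st32, st33, st36, st41, st48, st52]
       simp [kap, encS, zst]
       try ring)

theorem Fz_zst (s : St) (n : ℕ) : Fz s n zst = if zst = s then 1 else 0 := by
  induction n with
  | zero => rfl
  | succ n ih => rw [← ih]; exact st0 s n

theorem tot_rec5 (n : ℕ) : tot (n + 13) = tot (n + 11) + tot (n + 9) + tot (n + 7) + tot (n + 5) - 1 := by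
  have key : ∑ s : St, E5 (Gz s (n + 5)) s = -1 := by
    rw [Finset.sum_eq_single zst]
    · have : E5 (Gz zst (n + 5)) zst = E5 kap zst := by
        refine E5_congr fun a0 h0 a1 h1 a2 h2 a3 h3 a4 h4 => ?_
        rw [Gz_Q _ _ _ (E5_Q zst (by decide) a0 h0 a1 h1 a2 h2 a3 h3 a4 h4), Fz_zst]
        simp
      rw [this]; decide
    · intro s _ hs
      by_cases hU : inU s = true
      · rw [← E5_zero s]
        refine E5_congr fun a0 h0 a1 h1 a2 h2 a3 h3 a4 h4 => ?_
        rw [Gz_Q _ _ _ (E5_Q s hU a0 h0 a1 h1 a2 h2 a3 h3 a4 h4), Fz_zst, if_neg (Ne.symm hs)]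
        simp
      · have hU' : inU s = false := by simpa using hU
        rw [E5_Gz]
        simp [E5_notU s hU']
    · simp
  have h : ∀ m, tot m = ∑ s : St, E5 (Fz s m) s := fun m => rfl
  simp only [E5_Gz, Finset.sum_sub_distrib] at key
  simp only [h]
  linarith [key]

theorem tot_rec (n : ℕ) : tot (n + 8) = tot (n + 6) + tot (n + 4) + tot (n + 2) + tot n - 1 := by
  obtain ⟨h0, h2, h4, h6, h8, h10, h12⟩ := tot_vals
  obtain ⟨h1, h3, h5, h7, h9, h11⟩ := tot_odd
  rcases lt_or_ge n 5 with h | h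
  · interval_cases n <;> simp [*]
  · obtain ⟨m, rfl⟩ := Nat.exists_eq_add_of_le' h
    exact tot_rec5 m

/-- Weighted path sums, peeled at the far end. -/
def PS (T : ℕ → St → St → ℤ) : ℕ → (St → ℤ) → St → ℤ
  | 0, E => E
  | n + 1, E => PS T n (fun t => ∑ t', T n t t' * E t')

theorem path_sum (T : ℕ → St → St → ℤ) (n : ℕ) : ∀ (E : St → St → ℤ),
    ∑ w : Fin (n + 1) → St, (∏ i : Fin n, T i (w i.castSucc) (w i.succ)) * E (w 0) (w (Fin.last n))
      = ∑ s, PS T n (E s) s := by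
  induction n with
  | zero =>
    intro E
    rw [← (Equiv.funUnique (Fin 1) St).symm.sum_comp]
    simp [PS]
  | succ n ih =>
    intro E
    have h := ih (fun s t => ∑ t', T n t t' * E s t')
    simp only [PS]
    rw [← h]
    rw [← (Fin.snocEquiv (fun _ : Fin (n + 1 + 1) => St)).sum_comp, Fintype.sum_prod_type,
      Finset.sum_comm]
    refine Finset.sum_congr rfl fun w _ => ?_
    rw [Finset.mul_sum]
    refine Finset.sum_congr rfl fun t _ => ?_
    rw [Fin.prod_univ_castSucc]
    have h0 : (Fin.snoc w t : Fin (n + 2) → St) 0 = w 0 := by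
      have := Fin.snoc_castSucc (α := fun _ => St) t w 0
      exact this
    have h1 : ∀ i : Fin n, (Fin.snoc w t : Fin (n + 2) → St) i.castSucc.succ = w i.succ := by
      intro i
      rw [Fin.succ_castSucc]
      exact Fin.snoc_castSucc (α := fun _ => St) t w i.succ
    have h2 : ∀ i : Fin (n + 1), (Fin.snoc w t : Fin (n + 2) → St) i.castSucc = w i := fun i =>
      Fin.snoc_castSucc (α := fun _ => St) t w i
    have h3 : (Fin.snoc w t : Fin (n + 2) → St) (Fin.last (n + 1)) = t :=
      Fin.snoc_last (α := fun _ => St) t w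
    simp only [Fin.snocEquiv_apply, Fin.succ_last, h0, h1, h2, h3, Fin.val_castSucc, Fin.val_last]
    ring

theorem closed_sum (T : ℕ → St → St → ℤ) (n : ℕ) :
    ∑ w : Fin (n + 1) → St, ∏ i : Fin (n + 1), T i (w i) (w (i + 1))
      = ∑ s, PS T (n + 1) (fun t => if t = s then 1 else 0) s := by
  have h := path_sum T n (fun s t => T n t s)
  have h2 : ∀ s, (fun t => ∑ t', T n t t' * (if t' = s then 1 else 0)) = fun t => T n t s := by
    intro s; funext t; simp
  simp only [PS, h2]
  rw [← h]
  refine Finset.sum_congr rfl fun w _ => ?_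
  rw [Fin.prod_univ_castSucc]
  simp [Fin.coeSucc_eq_succ]

def TT (k : ℕ) (s s' : St) : ℤ :=
  (if ok k (cc s) false = true ∧ s' = nxt s false then 1 else 0) +
  (if ok k (cc s) true = true ∧ s' = nxt s true then 1 else 0)

theorem nxt_snd (s : St) (a : Bool) : (nxt s a).2.1 = a := rfl

theorem TT_eq (k : ℕ) (s s' : St) :
    TT k s s' = if (∃ a, ok k (cc s) a = true ∧ s' = nxt s a) then 1 else 0 := by
  have hne : nxt s false ≠ nxt s true := fun h => by
    have := congrArg (fun x : St => x.2.1) h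
    simp [nxt_snd] at this
  unfold TT
  by_cases h1 : ok k (cc s) false = true ∧ s' = nxt s false
  · have h2 : ¬ (ok k (cc s) true = true ∧ s' = nxt s true) := fun h => hne (h1.2.symm.trans h.2)
    rw [if_pos h1, if_neg h2, if_pos ⟨false, h1⟩]; rfl
  · by_cases h2 : ok k (cc s) true = true ∧ s' = nxt s true
    · rw [if_neg h1, if_pos h2, if_pos ⟨true, h2⟩]; rfl
    · rw [if_neg h1, if_neg h2, if_neg]
      · rfl
      · rintro ⟨a, ha⟩
        cases a
        · exact h1 ha
        · exact h2 ha

theorem TT_sum (k : ℕ) (F : St → ℤ) : (fun s => ∑ s', TT k s s' * F s') = L k F := by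
  funext s
  simp only [TT, L, add_mul, Finset.sum_add_distrib, ite_and]
  congr 1
  · split_ifs <;> simp
  · split_ifs <;> simp

theorem TT_big (k : ℕ) : TT (k + 5) = TT 5 := by
  funext s s'
  simp [TT, ok]

theorem PS_TT (E : St → ℤ) : PS TT 5 E = L 0 (L 1 (L 2 (L 3 (L 4 E)))) := by
  simp only [PS, TT_sum]

theorem L_big (k : ℕ) : L (k + 5) = L 5 := by
  funext F; rw [← TT_sum, ← TT_sum, TT_big]

theorem Fz_comm (s : St) (m : ℕ) (E : St → ℤ) (h : E = Fz s 0) :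
    PS TT (m + 5) E = L 0 (L 1 (L 2 (L 3 (L 4 (Fz s m))))) := by
  have gen : ∀ m r : ℕ, PS TT (m + 5) (Fz s r) = PS TT 5 (Fz s (r + m)) := by
    intro m
    induction m with
    | zero => intro r; rfl
    | succ m ih =>
      intro r
      have : PS TT (m + 1 + 5) (Fz s r) = PS TT (m + 5) (L (m + 5) (Fz s r)) := by
        rw [← TT_sum]; rfl
      rw [this, L_big]
      have h2 := ih (r + 1)
      rw [show r + (m + 1) = r + 1 + m by ring, ← h2]
      rfl
  rw [h, gen, PS_TT, Nat.zero_add]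

theorem closed_tot (n : ℕ) :
    ((Finset.univ.filter (fun w : ZMod (n + 5) → St =>
      ∀ j, ∃ a, ok j.val (cc (w j)) a = true ∧ w (j + 1) = nxt (w j) a)).card : ℤ) = tot n := by
  have h := closed_sum TT (n + 4)
  have h1 : ∀ s, PS TT (n + 5) (fun t => if t = s then 1 else 0) s =
      L 0 (L 1 (L 2 (L 3 (L 4 (Fz s n))))) s := fun s =>
    congrFun (Fz_comm s n _ rfl) s
  unfold tot
  simp only [← h1]
  rw [← h]
  rw [Finset.card_filter]
  push_cast
  simp only [TT_eq, Finset.prod_boole, Finset.mem_univ, true_imp_iff]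
  exact Finset.sum_congr rfl fun w _ => if_congr Iff.rfl rfl rfl

def Loc {d : ℕ} (q : ZMod d) (a f : ZMod d → Bool) : Prop :=
  ∀ j, f (j + 4) = ((a (j - 2) && a (j - 1)) || (a (j - 2) && f j) || (a (j - 1) && f j)) ∧
    ok (j - q).val (xor (xor (a (j - 2)) (a (j - 1))) (f j)) (a j) = true

instance {d : ℕ} [NeZero d] (q : ZMod d) (a f : ZMod d → Bool) : Decidable (Loc q a f) := by
  unfold Loc; infer_instance

theorem card_Loc0 (n : ℕ) :
    ((Finset.univ.filter (fun x : (ZMod (n + 5) → Bool) × (ZMod (n + 5) → Bool) =>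
      Loc 0 x.1 x.2)).card : ℤ) = tot n := by
  rw [← closed_tot]
  congr 1
  refine Finset.card_bij' (fun x _ j => (x.1 (j - 2), x.1 (j - 1), x.2 j, x.2 (j + 1), x.2 (j + 2), x.2 (j + 3)))
    (fun w _ => (fun j => (w (j + 1)).2.1, fun j => (w j).2.2.1)) ?_ ?_ ?_ ?_
  · rintro ⟨a, f⟩ h
    simp only [Finset.mem_filter, Finset.mem_univ, true_and] at h ⊢
    intro j
    obtain ⟨h1, h2⟩ := h j
    refine ⟨a j, ?_, ?_⟩
    · simpa [cc] using h2
    · simp only [nxt]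
      rw [← h1]
      refine Prod.ext ?_ (Prod.ext ?_ (Prod.ext ?_ (Prod.ext ?_ (Prod.ext ?_ ?_)))) <;>
        simp only <;> congr 1 <;> ring
  · rintro w h
    simp only [Finset.mem_filter, Finset.mem_univ, true_and] at h ⊢
    have H : ∀ j, w (j + 1) = nxt (w j) (w (j + 1)).2.1 ∧ ok j.val (cc (w j)) (w (j + 1)).2.1 = true := by
      intro j
      obtain ⟨a, h1, h2⟩ := h j
      have : (w (j + 1)).2.1 = a := by rw [h2]; rfl
      rw [this]; exact ⟨h2, h1⟩
    intro j
    have e1 : (w j).1 = (w (j - 2 + 1)).2.1 := by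
      have := congrArg (fun x : St => x.1) (H (j - 1)).1
      rw [show j - 1 + 1 = j by ring] at this
      rw [show j - 2 + 1 = j - 1 by ring]
      exact this
    have e2 : (w j).2.1 = (w (j - 1 + 1)).2.1 := by rw [show j - 1 + 1 = j by ring]
    have g1 : ∀ i, (w (i + 1)).2.2.1 = (w i).2.2.2.1 := fun i => congrArg (fun x : St => x.2.2.1) (H i).1
    have g2 : ∀ i, (w (i + 1)).2.2.2.1 = (w i).2.2.2.2.1 := fun i => congrArg (fun x : St => x.2.2.2.1) (H i).1
    have g3 : ∀ i, (w (i + 1)).2.2.2.2.1 = (w i).2.2.2.2.2 := fun i => congrArg (fun x : St => x.2.2.2.2.1) (H i).1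
    have g4 : (w (j + 1)).2.2.2.2.2 = (((w j).1 && (w j).2.1) || ((w j).1 && (w j).2.2.1) || ((w j).2.1 && (w j).2.2.1)) := congrArg (fun x : St => x.2.2.2.2.2) (H j).1
    refine ⟨?_, ?_⟩
    · simp only
      rw [← e1, ← e2, ← g4, ← g3, ← g2, ← g1]
      congr 4; ring
    · have := (H j).2
      simp only [sub_zero]
      rw [← e1, ← e2]
      exact this
  · rintro ⟨a, f⟩ h
    simp
  · rintro w h
    simp only [Finset.mem_filter, Finset.mem_univ, true_and] at h
    have H : ∀ j, w (j + 1) = nxt (w j) (w (j + 1)).2.1 ∧ ok j.val (cc (w j)) (w (j + 1)).2.1 = true := by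
      intro j
      obtain ⟨a, h1, h2⟩ := h j
      have : (w (j + 1)).2.1 = a := by rw [h2]; rfl
      rw [this]; exact ⟨h2, h1⟩
    have g0 : ∀ i, (w (i + 1)).1 = (w i).2.1 := fun i => congrArg (fun x : St => x.1) (H i).1
    have g1 : ∀ i, (w (i + 1)).2.2.1 = (w i).2.2.2.1 := fun i => congrArg (fun x : St => x.2.2.1) (H i).1
    have g2 : ∀ i, (w (i + 1)).2.2.2.1 = (w i).2.2.2.2.1 := fun i => congrArg (fun x : St => x.2.2.2.1) (H i).1
    have g3 : ∀ i, (w (i + 1)).2.2.2.2.1 = (w i).2.2.2.2.2 := fun i => congrArg (fun x : St => x.2.2.2.2.1) (H i).1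
    funext j
    refine Prod.ext ?_ (Prod.ext ?_ (Prod.ext ?_ (Prod.ext ?_ (Prod.ext ?_ ?_)))) <;> simp only
    · rw [← g0]; congr 2; ring
    · congr 3; ring
    · rw [g1]
    · rw [← g2, ← g1]; congr 4; ring
    · rw [← g3, ← g2, ← g1]; congr 4; ring

/-- Cyclic evaluation at 2 starting from position `i`. -/
def XX {d : ℕ} (u : ZMod d → ℤ) (i : ZMod d) : ℤ := ∑ t ∈ Finset.range d, 2 ^ t * u (i + t)

theorem XX_step {d : ℕ} (u : ZMod d → ℤ) (i : ZMod d) :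
    XX u i + (2 ^ d - 1) * u i = 2 * XX u (i + 1) := by
  have h1 := Finset.sum_range_succ (fun t : ℕ => (2 : ℤ) ^ t * u (i + t)) d
  have h2 := Finset.sum_range_succ' (fun t : ℕ => (2 : ℤ) ^ t * u (i + t)) d
  have h3 : ∑ t ∈ Finset.range d, (2 : ℤ) ^ (t + 1) * u (i + ((t + 1 : ℕ) : ZMod d))
      = 2 * XX u (i + 1) := by
    unfold XX
    rw [Finset.mul_sum]
    refine Finset.sum_congr rfl fun t _ => ?_
    have : i + ((t + 1 : ℕ) : ZMod d) = i + 1 + t := by push_cast; ring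
    rw [this]; ring
  rw [h3] at h2
  have h4 : XX u i = ∑ t ∈ Finset.range d, (2 : ℤ) ^ t * u (i + t) := rfl
  rw [← h4] at h1
  rw [h1] at h2
  simp only [ZMod.natCast_self, add_zero, Nat.cast_zero, pow_zero, one_mul] at h2
  linarith

theorem XX_sub {d : ℕ} (u v : ZMod d → ℤ) (i : ZMod d) :
    XX (fun j => u j - v j) i = XX u i - XX v i := by
  simp [XX, mul_sub, Finset.sum_sub_distrib]

theorem XX_add {d : ℕ} (u v : ZMod d → ℤ) (i : ZMod d) :
    XX (fun j => u j + v j) i = XX u i + XX v i := by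
  simp [XX, mul_add, Finset.sum_add_distrib]

theorem XX_carry {d : ℕ} (u φ : ZMod d → ℤ) (h : ∀ i, u i = 2 * φ (i + 1) - φ i) :
    XX u 0 = (2 ^ d - 1) * φ 0 := by
  have h1 : XX u 0 = 2 * XX φ 1 - XX φ 0 := by
    unfold XX
    rw [Finset.mul_sum, ← Finset.sum_sub_distrib]
    refine Finset.sum_congr rfl fun t _ => ?_
    rw [h, show (0 : ZMod d) + t + 1 = 1 + t by ring]; ring
  have h2 := XX_step φ 0
  rw [zero_add] at h2
  linarith

theorem XX_shift {d : ℕ} (u : ZMod d → ℤ) (n : ℕ) (i : ZMod d) :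
    ((2 : ℤ) ^ d - 1) ∣ 2 ^ n * XX u (i + n) - XX u i := by
  induction n with
  | zero => simp
  | succ n ih =>
    have h := XX_step u (i + n)
    have e : i + ((n + 1 : ℕ) : ZMod d) = i + n + 1 := by push_cast; ring
    rw [e]
    have : 2 ^ (n + 1) * XX u (i + n + 1) - XX u i
        = (2 ^ n * XX u (i + n) - XX u i) + (2 ^ d - 1) * (2 ^ n * u (i + n)) := by
      rw [pow_succ, mul_assoc, ← h]; ring
    rw [this]
    exact dvd_add ih (Dvd.intro _ rfl)

theorem XX_shift0 {d : ℕ} (u : ZMod d → ℤ) (n : ℕ) :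
    ((2 : ℤ) ^ d - 1) ∣ 2 ^ n * XX u 0 - XX (fun i : ZMod d => u (i - n)) 0 := by
  have h := XX_shift u n (-n)
  have e : XX (fun i : ZMod d => u (i - n)) 0 = XX u (-n) := by
    unfold XX
    refine Finset.sum_congr rfl fun t _ => ?_
    congr 2; ring
  rw [e]
  simpa using h

theorem geom2 (d : ℕ) : ∑ t ∈ Finset.range d, (2 : ℤ) ^ t = 2 ^ d - 1 := by
  induction d with
  | zero => simp
  | succ n ih => rw [Finset.sum_range_succ, ih, pow_succ]; ring

theorem XX_lt {d : ℕ} [NeZero d] (u : ZMod d → ℤ) (H : ℤ) (h : ∀ i, u i ≤ H) (i0 : ZMod d)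
    (h0 : u i0 < H) (i : ZMod d) : XX u i < (2 ^ d - 1) * H := by
  rw [← geom2, Finset.sum_mul]
  unfold XX
  refine Finset.sum_lt_sum (fun t _ => ?_) ⟨(i0 - i).val, ?_, ?_⟩
  · have := h (i + t)
    gcongr
  · exact Finset.mem_range.mpr (ZMod.val_lt _)
  · rw [ZMod.natCast_zmod_val, add_sub_cancel]
    gcongr

theorem XX_gt {d : ℕ} [NeZero d] (u : ZMod d → ℤ) (H : ℤ) (h : ∀ i, H ≤ u i) (i0 : ZMod d)
    (h0 : H < u i0) (i : ZMod d) : (2 ^ d - 1) * H < XX u i := by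
  rw [← geom2, Finset.sum_mul]
  unfold XX
  refine Finset.sum_lt_sum (fun t _ => ?_) ⟨(i0 - i).val, ?_, ?_⟩
  · have := h (i + t)
    gcongr
  · exact Finset.mem_range.mpr (ZMod.val_lt _)
  · rw [ZMod.natCast_zmod_val, add_sub_cancel]
    gcongr

/-- Existence of a cyclic carry sequence with values in `{0,1}`. -/
theorem carry_exists {d : ℕ} [NeZero d] (u : ZMod d → ℤ) (h : ((2 : ℤ) ^ d - 1) ∣ XX u 0)
    (hlo : ∀ i, -1 ≤ u i) (hhi : ∀ i, u i ≤ 2) (hl : ∃ i, -1 < u i) (hh : ∃ i, u i < 2) :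
    ∃ φ : ZMod d → ℤ, (∀ i, φ i = 0 ∨ φ i = 1) ∧ ∀ i, u i = 2 * φ (i + 1) - φ i := by
  have hpos : (0 : ℤ) < 2 ^ d - 1 := by
    have : (2 : ℤ) ^ 1 ≤ 2 ^ d := pow_le_pow_right₀ (by norm_num) (NeZero.one_le)
    linarith
  have hcop : IsCoprime ((2 : ℤ) ^ d - 1) 2 := by
    obtain ⟨e, he⟩ := Nat.exists_eq_succ_of_ne_zero (NeZero.ne d)
    refine ⟨-1, 2 ^ e, ?_⟩
    rw [he, Nat.succ_eq_add_one, pow_succ]; ring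
  have hall : ∀ n : ℕ, ((2 : ℤ) ^ d - 1) ∣ XX u n := by
    intro n
    induction n with
    | zero => simpa using h
    | succ n ih =>
      have hs := XX_step u n
      push_cast
      refine hcop.dvd_of_dvd_mul_left ?_
      rw [← hs]
      exact dvd_add ih (Dvd.intro _ rfl)
  have hall' : ∀ i : ZMod d, ∃ c, XX u i = (2 ^ d - 1) * c := by
    intro i
    have := hall i.val
    rwa [ZMod.natCast_zmod_val] at this
  choose φ hφ using hall'
  refine ⟨φ, fun i => ?_, fun i => ?_⟩
  · obtain ⟨i1, h1⟩ := hl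
    obtain ⟨i2, h2⟩ := hh
    have a1 := XX_gt u (-1) hlo i1 h1 i
    have a2 := XX_lt u 2 hhi i2 h2 i
    rw [hφ] at a1 a2
    have b1 := lt_of_mul_lt_mul_left a1 hpos.le
    have b2 := lt_of_mul_lt_mul_left a2 hpos.le
    omega
  · have hs := XX_step u i
    rw [hφ, hφ (i + 1)] at hs
    have : (2 ^ d - 1) * (φ i + u i) = (2 ^ d - 1) * (2 * φ (i + 1)) := by linarith
    have := mul_left_cancel₀ hpos.ne' this
    linarith

theorem bits_inj (n : ℕ) : ∀ u v : ℕ → ℤ, (∀ t, u t = 0 ∨ u t = 1) → (∀ t, v t = 0 ∨ v t = 1) →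
    ∑ t ∈ Finset.range n, 2 ^ t * u t = ∑ t ∈ Finset.range n, 2 ^ t * v t → ∀ t < n, u t = v t := by
  induction n with
  | zero => intro u v _ _ _ t ht; omega
  | succ n ih =>
    intro u v hu hv h
    rw [Finset.sum_range_succ', Finset.sum_range_succ'] at h
    have e : ∀ w : ℕ → ℤ, ∑ t ∈ Finset.range n, (2 : ℤ) ^ (t + 1) * w (t + 1)
        = 2 * ∑ t ∈ Finset.range n, 2 ^ t * w (t + 1) := by
      intro w
      rw [Finset.mul_sum]
      refine Finset.sum_congr rfl fun t _ => ?_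
      ring
    rw [e u, e v] at h
    simp only [pow_zero, one_mul] at h
    have hu0 := hu 0
    have hv0 := hv 0
    have h0 : u 0 = v 0 := by omega
    have h1 := ih (fun t => u (t + 1)) (fun t => v (t + 1)) (fun t => hu _) (fun t => hv _) (by omega)
    intro t ht
    cases t with
    | zero => exact h0
    | succ t => exact h1 t (by omega)

theorem XX_inj {d : ℕ} [NeZero d] (u v : ZMod d → ℤ) (hu : ∀ t, u t = 0 ∨ u t = 1)
    (hv : ∀ t, v t = 0 ∨ v t = 1) (h : XX u 0 = XX v 0) : u = v := by
  have := bits_inj d (fun t => u (0 + t)) (fun t => v (0 + t)) (fun t => hu _) (fun t => hv _) h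
  funext i
  have := this i.val (ZMod.val_lt i)
  simpa using this

def bt (d : ℕ) (x : ℕ) : ZMod d → ℤ := fun i => ((x / 2 ^ i.val % 2 : ℕ) : ℤ)

theorem bt01 (d x : ℕ) (i : ZMod d) : bt d x i = 0 ∨ bt d x i = 1 := by
  unfold bt
  have := Nat.mod_two_eq_zero_or_one (x / 2 ^ i.val)
  omega

theorem bits_sum (n : ℕ) : ∀ x < 2 ^ n, ∑ t ∈ Finset.range n, 2 ^ t * (x / 2 ^ t % 2) = x := by
  induction n with
  | zero => intro x hx; simp at hx ⊢; omega
  | succ n ih =>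
    intro x hx
    rw [Finset.sum_range_succ']
    have h := ih (x / 2) (by rw [pow_succ] at hx; omega)
    have e : ∑ t ∈ Finset.range n, 2 ^ (t + 1) * (x / 2 ^ (t + 1) % 2)
        = 2 * ∑ t ∈ Finset.range n, 2 ^ t * (x / 2 / 2 ^ t % 2) := by
      rw [Finset.mul_sum]
      refine Finset.sum_congr rfl fun t _ => ?_
      rw [Nat.div_div_eq_div_mul, ← pow_succ']
      ring
    rw [e, h]
    simp
    omega

theorem digits_count (n : ℕ) : ∀ x < 2 ^ n,
    (Nat.digits 2 x).count 1 = ∑ t ∈ Finset.range n, (x / 2 ^ t % 2) := by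
  induction n with
  | zero => intro x hx; simp at hx; simp [hx]
  | succ n ih =>
    intro x hx
    rw [Finset.sum_range_succ']
    have h := ih (x / 2) (by rw [pow_succ] at hx; omega)
    have e : ∑ t ∈ Finset.range n, (x / 2 ^ (t + 1) % 2)
        = ∑ t ∈ Finset.range n, (x / 2 / 2 ^ t % 2) := by
      refine Finset.sum_congr rfl fun t _ => ?_
      rw [Nat.div_div_eq_div_mul, ← pow_succ']
    rw [e, ← h]
    rcases Nat.eq_zero_or_pos x with rfl | hx0
    · simp
    · rw [Nat.digits_def' (by norm_num) hx0, List.count_cons]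
      have := Nat.mod_two_eq_zero_or_one x
      rcases this with h2 | h2 <;> simp [h2]

theorem bt_natCast (d x t : ℕ) (ht : t < d) : bt d x t = ((x / 2 ^ t % 2 : ℕ) : ℤ) := by
  unfold bt; rw [ZMod.val_natCast, Nat.mod_eq_of_lt ht]

theorem XX_bt (d x : ℕ) (hx : x < 2 ^ d) : XX (bt d x) 0 = x := by
  conv_rhs => rw [← bits_sum d x hx]
  unfold XX
  push_cast
  refine Finset.sum_congr rfl fun t ht => ?_
  rw [zero_add, bt_natCast d x t (Finset.mem_range.mp ht)]
  push_cast; rfl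

theorem sum_range_zmod (d : ℕ) [NeZero d] (u : ZMod d → ℤ) :
    ∑ t ∈ Finset.range d, u t = ∑ i, u i := by
  refine Finset.sum_bij' (fun t _ => (t : ZMod d)) (fun i _ => i.val) ?_ ?_ ?_ ?_ ?_
  · simp
  · intro i _; exact Finset.mem_range.mpr (ZMod.val_lt i)
  · intro t ht; exact ZMod.val_cast_of_lt (Finset.mem_range.mp ht)
  · intro i _; simp
  · simp

theorem sBin_eq (d x : ℕ) [NeZero d] :
    (sBin d x : ℤ) = ∑ i, bt d (x % (2 ^ d - 1)) i := by
  have hm : 0 < 2 ^ d - 1 := by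
    have : 2 ^ 1 ≤ 2 ^ d := Nat.pow_le_pow_right (by norm_num) (NeZero.one_le)
    omega
  have hlt := Nat.mod_lt x hm
  unfold sBin
  rw [digits_count d _ (by omega), ← sum_range_zmod]
  push_cast
  refine Finset.sum_congr rfl fun t ht => ?_
  rw [bt_natCast d _ t (Finset.mem_range.mp ht)]
  push_cast; rfl

theorem bt_exists {d : ℕ} [NeZero d] (u : ZMod d → ℤ) (hu : ∀ t, u t = 0 ∨ u t = 1)
    (i0 : ZMod d) (h0 : u i0 = 0) :
    ∃ x : ℕ, x < 2 ^ d - 1 ∧ bt d x = u ∧ XX u 0 = x := by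
  have h1 := XX_lt u 1 (fun i => by have := hu i; omega) i0 (by omega) 0
  have h2 : 0 ≤ XX u 0 := Finset.sum_nonneg fun t _ => by
    have : 0 ≤ u (0 + t) := by have := hu (0 + t); omega
    positivity
  obtain ⟨x, hx⟩ := Int.eq_ofNat_of_zero_le h2
  rw [hx, mul_one] at h1
  have h3 : x < 2 ^ d - 1 := by
    have : ((x + 1 : ℕ) : ℤ) < ((2 ^ d : ℕ) : ℤ) := by push_cast; linarith
    have := Int.ofNat_lt.mp this
    omega
  refine ⟨x, h3, ?_, hx⟩
  refine XX_inj _ _ (bt01 d x) hu ?_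
  rw [XX_bt d x (by omega), hx]

theorem bt_zero_exists {d : ℕ} [NeZero d] (x : ℕ) (hx : x < 2 ^ d - 1) : ∃ i, bt d x i = 0 := by
  by_contra hc
  push Not at hc
  have h1 : ∀ i, bt d x i = 1 := fun i => by have := bt01 d x i; have := hc i; omega
  have h2 := XX_bt d x (by omega)
  unfold XX at h2
  simp only [h1, mul_one, geom2] at h2
  have : ((x + 1 : ℕ) : ℤ) = ((2 ^ d : ℕ) : ℤ) := by push_cast; linarith
  have := Int.ofNat_inj.mp this
  omega

theorem dvd_transport {m a b : ℤ} (h : m ∣ a) (e : b = a) : m ∣ b := e ▸ h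

def iot (b : Bool) : ℤ := if b then 1 else 0

theorem iot01 (b : Bool) : iot b = 0 ∨ iot b = 1 := by cases b <;> simp [iot]

theorem iot_inj {b c : Bool} (h : iot b = iot c) : b = c := by
  cases b <;> cases c <;> simp [iot] at h ⊢

theorem loc_maj (p q r : Bool) : iot q + iot p - iot (xor (xor p q) r)
    = 2 * iot ((p && q) || (p && r) || (q && r)) - iot r := by
  cases p <;> cases q <;> cases r <;> simp [iot]

theorem mod_unique {d : ℕ} [NeZero d] (y z : ℕ) (hy : y < 2 ^ d - 1)
    (h : ((2 : ℤ) ^ d - 1) ∣ (z : ℤ) - y) : z % (2 ^ d - 1) = y := by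
  have hm : ((2 ^ d - 1 : ℕ) : ℤ) = 2 ^ d - 1 := by
    have : 1 ≤ 2 ^ d := Nat.one_le_two_pow
    push_cast [this]; rfl
  rw [← hm] at h
  have h2 : y ≡ z [MOD (2 ^ d - 1)] := (Nat.modEq_iff_dvd).mpr h
  have h3 : y % (2 ^ d - 1) = z % (2 ^ d - 1) := h2
  rw [← h3, Nat.mod_eq_of_lt hy]

theorem XX_k {d : ℕ} (g : ZMod d) (e1 e2 : ℕ) (h1 : (e1 : ZMod d) = 2 * g) (h2 : (e2 : ZMod d) = g)
    (u : ZMod d → ℤ) :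
    ((2 : ℤ) ^ d - 1) ∣ (2 ^ e1 + 2 ^ e2) * XX u 0 - XX (fun i => u (i - g) + u (i - 2 * g)) 0 := by
  have a1 := XX_shift0 u e1
  have a2 := XX_shift0 u e2
  rw [h1] at a1
  rw [h2] at a2
  rw [XX_add]
  have := dvd_add a1 a2
  refine dvd_transport this ?_
  ring

section main
variable {d : ℕ} [NeZero d] (g : ZMod d) (e1 e2 : ℕ)

theorem forward (h1 : (e1 : ZMod d) = 2 * g) (h2 : (e2 : ZMod d) = g)
    (hg : 4 * g = 1) (hd : 5 ≤ d) (q : ZMod d) (a f : ZMod d → Bool) (hL : Loc q a f) :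
    ∃ x : ℕ, 0 < x ∧ x < 2 ^ d - 1 ∧ bt d x = (fun i => iot (a (4 * i))) ∧
      bt d ((2 ^ e1 + 2 ^ e2) * x % (2 ^ d - 1)) =
        (fun i => iot (xor (xor (a (4 * i - 2)) (a (4 * i - 1))) (f (4 * i)))) ∧
      sBin d x + sBin d ((2 ^ e1 + 2 ^ e2 - 1) * x) = sBin d ((2 ^ e1 + 2 ^ e2) * x) + 1 := by
  have hv4 : (4 : ZMod d).val = 4 := by
    have := ZMod.val_natCast_of_lt (n := d) (a := 4) (by omega)
    simpa using this
  have h40 : (4 : ZMod d) ≠ 0 := by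
    intro h; rw [h, ZMod.val_zero] at hv4; omega
  set α : ZMod d → ℤ := fun i => iot (a (4 * i)) with hα
  set c : ZMod d → ℤ := fun i => iot (xor (xor (a (4 * i - 2)) (a (4 * i - 1))) (f (4 * i))) with hc
  set φ : ZMod d → ℤ := fun i => iot (f (4 * i)) with hφ
  set ε : ZMod d → ℤ := fun i => if 4 * i = q + 4 then 1 else 0 with hε
  set b : ZMod d → ℤ := fun i => c i - α i - ε i + 2 * ε (i + 1) with hb
  have hcar : ∀ i, (α (i - g) + α (i - 2 * g)) - c i = 2 * φ (i + 1) - φ i := by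
    intro i
    have hj := (hL (4 * i)).1
    have i1 : 4 * (i - g) = 4 * i - 1 := by rw [mul_sub, hg]
    have i2 : 4 * (i - 2 * g) = 4 * i - 2 := by linear_combination (-2) * hg
    have i3 : 4 * (i + 1) = 4 * i + 4 := by ring
    simp only [hα, hc, hφ, i1, i2, i3, hj]
    exact loc_maj _ _ _
  -- values at the special positions
  have hq0 := (hL q).2
  have hq4 := (hL (q + 4)).2
  have hother : ∀ j, j ≠ q → j ≠ q + 4 → 
      iot (a j) ≤ iot (xor (xor (a (j - 2)) (a (j - 1))) (f j)) := by
    intro j n0 n4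
    have := (hL j).2
    have m0 : (j - q).val ≠ 0 := by
      intro h; rw [ZMod.val_eq_zero] at h; exact n0 (sub_eq_zero.mp h)
    have m4 : (j - q).val ≠ 4 := by
      intro h
      rw [← hv4] at h
      have := ZMod.val_injective d h
      exact n4 (by rw [← this]; ring)
    rw [ok, if_neg m0, if_neg m4] at this
    revert this
    generalize xor (xor (a (j - 2)) (a (j - 1))) (f j) = C
    cases a j <;> cases C <;> simp [iot]
  rw [sub_self, ZMod.val_zero] at hq0
  rw [add_sub_cancel_left, hv4] at hq4
  simp only [ok, if_true, Bool.and_eq_true, Bool.not_eq_true'] at hq0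
  rw [ok, if_neg (by norm_num), if_pos rfl] at hq4
  simp only [Bool.and_eq_true, Bool.not_eq_true'] at hq4
  have inv4 : ∀ j : ZMod d, 4 * (g * j) = j := fun j => by rw [← mul_assoc, hg, one_mul]
  have unit4 : ∀ i j : ZMod d, 4 * i = j → i = g * j := fun i j h => by
    rw [← h, ← mul_assoc, mul_comm g 4, hg, one_mul]
  have hb01 : ∀ i, b i = 0 ∨ b i = 1 := by
    intro i
    have i3 : 4 * (i + 1) = q + 4 ↔ 4 * i = q := by
      constructor
      · intro h; linear_combination h
      · intro h; linear_combination h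
    by_cases p0 : 4 * i = q
    · have : ¬ (4 * i = q + 4) := by
        rw [p0]; intro h; exact h40 (by linear_combination -h)
      simp only [hb, hc, hα, hε, i3, p0, hq0.1, hq0.2, if_true]
      simp [iot, h40]
    · by_cases p4 : 4 * i = q + 4
      · simp only [hb, hc, hα, hε, i3, p4, hq4.1, hq4.2, if_true]
        simp [iot, h40]
      · have := hother (4 * i) p0 p4
        simp only [hb, hc, hα, hε, i3, if_neg p0, if_neg p4]
        have h1 := iot01 (a (4 * i))
        have h2 := iot01 (xor (xor (a (4 * i - 2)) (a (4 * i - 1))) (f (4 * i)))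
        omega
  have hα4 : α (g * (q + 4)) = 0 := by simp only [hα, inv4, hq4.1]; rfl
  have hα0 : α (g * q) = 1 := by simp only [hα, inv4, hq0.1]; rfl
  have hc0 : c (g * q) = 0 := by simp only [hc, inv4, hq0.2]; rfl
  have hc4 : c (g * (q + 4)) = 1 := by simp only [hc, inv4, hq4.2]; rfl
  have hb4 : b (g * (q + 4)) = 0 := by
    have : ¬ (4 * (g * (q + 4) + 1) = q + 4) := by
      intro h; rw [mul_add, inv4] at h; exact h40 (by linear_combination h)
    simp only [hb, hc4, hα4, hε, inv4, if_true, if_neg this]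
    norm_num
  obtain ⟨x, hx, hbx, hXx⟩ := bt_exists α (fun i => iot01 _) _ hα4
  obtain ⟨y, hy, hby, hXy⟩ := bt_exists c (fun i => iot01 _) _ hc0
  obtain ⟨z, hz, hbz, hXz⟩ := bt_exists b hb01 _ hb4
  have hx0 : 0 < x := by
    rcases Nat.eq_zero_or_pos x with h | h
    · rw [← hbx, h] at hα0; simp [bt] at hα0
    · exact h
  -- congruences
  have c1 := XX_carry _ _ hcar
  rw [XX_sub] at c1
  have c2 := XX_k g e1 e2 h1 h2 α
  have c3 := XX_carry (fun i => (α i + b i) - c i) ε (fun i => by simp only [hb]; ring)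
  rw [XX_sub, XX_add] at c3
  have hky : (2 ^ e1 + 2 ^ e2) * x % (2 ^ d - 1) = y := by
    apply mod_unique _ _ hy
    push_cast
    rw [← hXx, ← hXy]
    have : (2 ^ e1 + 2 ^ e2) * XX α 0 - XX c 0 =
      ((2 ^ e1 + 2 ^ e2) * XX α 0 - XX (fun i => α (i - g) + α (i - 2 * g)) 0)
        + (2 ^ d - 1) * φ 0 := by rw [← c1]; ring
    rw [this]
    exact dvd_add c2 (Dvd.intro _ rfl)
  have hk1 : 1 ≤ 2 ^ e1 + 2 ^ e2 := le_trans (Nat.one_le_two_pow (n := e1)) (Nat.le_add_right _ _)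
  have hkz : (2 ^ e1 + 2 ^ e2 - 1) * x % (2 ^ d - 1) = z := by
    apply mod_unique _ _ hz
    push_cast [hk1]
    rw [← hXx, ← hXz]
    have : (2 ^ e1 + 2 ^ e2 - 1) * XX α 0 - XX b 0 =
      ((2 ^ e1 + 2 ^ e2) * XX α 0 - XX (fun i => α (i - g) + α (i - 2 * g)) 0)
        + (2 ^ d - 1) * (φ 0 - ε 0) := by rw [mul_sub, ← c1, ← c3]; ring
    rw [this]
    exact dvd_add c2 (Dvd.intro _ rfl)
  refine ⟨x, hx0, hx, hbx, ?_, ?_⟩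
  · rw [hky, hby]
  · have s1 := sBin_eq d x
    have s2 := sBin_eq d ((2 ^ e1 + 2 ^ e2 - 1) * x)
    have s3 := sBin_eq d ((2 ^ e1 + 2 ^ e2) * x)
    rw [Nat.mod_eq_of_lt hx, hbx] at s1
    rw [hkz, hbz] at s2
    rw [hky, hby] at s3
    have sε : ∑ i, ε i = 1 := by
      rw [Finset.sum_eq_single (g * (q + 4))]
      · simp only [hε, inv4, if_true]
      · intro i _ hi
        simp only [hε]
        rw [if_neg]
        intro h; exact hi (unit4 _ _ h)
      · simp
    have sε1 : ∑ i, ε (i + 1) = 1 := by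
      rw [← sε]; exact Equiv.sum_comp (Equiv.addRight (1 : ZMod d)) ε
    have sb : ∑ i, b i = ∑ i, c i - ∑ i, α i - ∑ i, ε i + 2 * ∑ i, ε (i + 1) := by
      simp only [hb, Finset.sum_add_distrib, Finset.sum_sub_distrib, Finset.mul_sum]
    rw [sε, sε1] at sb
    zify
    linarith

theorem backward (h1 : (e1 : ZMod d) = 2 * g) (h2 : (e2 : ZMod d) = g)
    (hg : 4 * g = 1) (hd : 5 ≤ d) (x : ℕ) (hx0 : 0 < x) (hx : x < 2 ^ d - 1)
    (hs : sBin d x + sBin d ((2 ^ e1 + 2 ^ e2 - 1) * x) = sBin d ((2 ^ e1 + 2 ^ e2) * x) + 1) :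
    ∃ q a f, Loc (d := d) q a f ∧ bt d x = (fun i => iot (a (4 * i))) := by
  have hv4 : (4 : ZMod d).val = 4 := by
    have := ZMod.val_natCast_of_lt (n := d) (a := 4) (by omega)
    simpa using this
  have hm : 0 < 2 ^ d - 1 := by omega
  have hk1 : 1 ≤ 2 ^ e1 + 2 ^ e2 := le_trans (Nat.one_le_two_pow (n := e1)) (Nat.le_add_right _ _)
  have hmz : ((2 ^ d - 1 : ℕ) : ℤ) = 2 ^ d - 1 := by
    have : 1 ≤ 2 ^ d := Nat.one_le_two_pow
    push_cast [this]; rfl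
  obtain ⟨y, hy⟩ : ∃ y, y = (2 ^ e1 + 2 ^ e2) * x % (2 ^ d - 1) := ⟨_, rfl⟩
  obtain ⟨z, hz⟩ : ∃ z, z = (2 ^ e1 + 2 ^ e2 - 1) * x % (2 ^ d - 1) := ⟨_, rfl⟩
  have hym : y < 2 ^ d - 1 := hy ▸ Nat.mod_lt _ hm
  have hzm : z < 2 ^ d - 1 := hz ▸ Nat.mod_lt _ hm
  have dy : ((2 : ℤ) ^ d - 1) ∣ (2 ^ e1 + 2 ^ e2) * x - y := by
    have := (Nat.modEq_iff_dvd).mp (Nat.mod_modEq ((2 ^ e1 + 2 ^ e2) * x) (2 ^ d - 1))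
    rw [← hy, hmz] at this
    push_cast at this; exact this
  have dz : ((2 : ℤ) ^ d - 1) ∣ (2 ^ e1 + 2 ^ e2 - 1) * x - z := by
    have := (Nat.modEq_iff_dvd).mp (Nat.mod_modEq ((2 ^ e1 + 2 ^ e2 - 1) * x) (2 ^ d - 1))
    rw [← hz, hmz] at this
    push_cast [hk1] at this; exact this
  obtain ⟨i1, hi1⟩ := bt_zero_exists (d := d) x hx
  obtain ⟨i2, hi2⟩ := bt_zero_exists (d := d) y hym
  have xα := XX_bt d x (by omega)
  have xc := XX_bt d y (by omega)
  have xb := XX_bt d z (by omega)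
  have α01 := bt01 d x
  have c01 := bt01 d y
  have b01 := bt01 d z
  have s1 := sBin_eq d x
  have s2 := sBin_eq d ((2 ^ e1 + 2 ^ e2 - 1) * x)
  have s3 := sBin_eq d ((2 ^ e1 + 2 ^ e2) * x)
  rw [Nat.mod_eq_of_lt hx] at s1
  rw [← hz] at s2
  rw [← hy] at s3
  generalize bt d x = α at *
  generalize bt d y = c at *
  generalize bt d z = b at *
  obtain ⟨φ, φ01, hφ⟩ := carry_exists (fun i => (α (i - g) + α (i - 2 * g)) - c i) (by
      rw [XX_sub, xc]
      have c2 := XX_k g e1 e2 h1 h2 α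
      rw [xα] at c2
      have := dvd_sub dy c2
      refine dvd_transport this ?_
      ring)
    (fun i => by have := α01 (i - g); have := α01 (i - 2 * g); have := c01 i; omega)
    (fun i => by have := α01 (i - g); have := α01 (i - 2 * g); have := c01 i; omega)
    ⟨i2, by have := α01 (i2 - g); have := α01 (i2 - 2 * g); omega⟩
    ⟨i1 + g, by
      have := α01 (i1 + g - 2 * g); have := c01 (i1 + g); simp only [add_sub_cancel_right]; omega⟩
  obtain ⟨ε, ε01, hε⟩ := carry_exists (fun i => (α i + b i) - c i) (by
      rw [XX_sub, XX_add, xc, xα, xb]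
      have := dvd_sub dy dz
      refine dvd_transport this ?_
      ring)
    (fun i => by have := α01 i; have := b01 i; have := c01 i; omega)
    (fun i => by have := α01 i; have := b01 i; have := c01 i; omega)
    ⟨i2, by have := α01 i2; have := b01 i2; omega⟩
    ⟨i1, by have := b01 i1; have := c01 i1; omega⟩
  have sε1 : ∑ i, ε (i + 1) = ∑ i, ε i := Equiv.sum_comp (Equiv.addRight (1 : ZMod d)) ε
  have sum1 : ∑ i, ε i = 1 := by
    have : ∑ i, ((α i + b i) - c i) = ∑ i, (2 * ε (i + 1) - ε i) :=
      Finset.sum_congr rfl fun i _ => hε i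
    simp only [Finset.sum_sub_distrib, Finset.sum_add_distrib, ← Finset.mul_sum, sε1] at this
    zify at hs
    linarith
  obtain ⟨p, hp⟩ : ∃ p, ε p = 1 := by
    by_contra hc
    push Not at hc
    have : ∀ i, ε i = 0 := fun i => by have := ε01 i; have := hc i; omega
    simp [this] at sum1
  have hpu : ∀ i, i ≠ p → ε i = 0 := by
    intro i hi
    have h := Finset.add_sum_erase Finset.univ ε (Finset.mem_univ p)
    have h' := Finset.single_le_sum (f := ε) (s := Finset.univ.erase p)
      (fun j _ => by have := ε01 j; omega) (Finset.mem_erase.mpr ⟨hi, Finset.mem_univ i⟩)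
    have := ε01 i
    omega
  have inv4 : ∀ i : ZMod d, g * (4 * i) = i := fun i => by rw [← mul_assoc, mul_comm g 4, hg, one_mul]
  have io : ∀ (u : ZMod d → ℤ) (hu : ∀ i, u i = 0 ∨ u i = 1) i, iot (decide (u i = 1)) = u i := by
    intro u hu i
    rcases hu i with h | h <;> simp [h, iot]
  refine ⟨4 * (p - 1), fun j => decide (α (g * j) = 1), fun j => decide (φ (g * j) = 1), ?_, ?_⟩
  · intro j
    obtain ⟨i, rfl⟩ : ∃ i, j = 4 * i := ⟨g * j, by rw [← mul_assoc, hg, one_mul]⟩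
    have j1 : g * (4 * i - 1) = i - g := by rw [mul_sub, inv4, mul_one]
    have j2 : g * (4 * i - 2) = i - 2 * g := by rw [mul_sub, inv4, mul_comm g 2]
    have j4 : g * (4 * i + 4) = i + 1 := by
      rw [show 4 * i + 4 = 4 * (i + 1) by ring, inv4]
    simp only [j1, j2, j4, inv4]
    have A1 := io α α01 (i - g)
    have A2 := io α α01 (i - 2 * g)
    have A0 := io α α01 i
    have P0 := io φ φ01 i
    have P1 := io φ φ01 (i + 1)
    have hφi := hφ i
    rw [← A1, ← A2, ← P0, ← P1] at hφi
    have hεi := hε i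
    rw [← A0] at hεi
    generalize decide (α (i - g) = 1) = a1 at *
    generalize decide (α (i - 2 * g) = 1) = a2 at *
    generalize decide (α i = 1) = a0 at *
    generalize decide (φ i = 1) = f0 at *
    generalize decide (φ (i + 1) = 1) = f1 at *
    have hc := c01 i
    have hb := b01 i
    have hcx : c i = iot (xor (xor a2 a1) f0) ∧ f1 = ((a2 && a1) || (a2 && f0) || (a1 && f0)) := by
      have := loc_maj a2 a1 f0
      have g1 := iot01 f1
      have g2 := iot01 ((a2 && a1) || (a2 && f0) || (a1 && f0))
      have g3 := iot01 (xor (xor a2 a1) f0)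
      constructor
      · omega
      · apply iot_inj; omega
    refine ⟨hcx.2, ?_⟩
    rw [hcx.1] at hεi
    generalize xor (xor a2 a1) f0 = C at *
    have a01 := iot01 a0
    have C01 := iot01 C
    by_cases q0 : i = p - 1
    · have e0 : ε i = 0 := hpu i (by
        rw [q0]; intro h
        have : (1 : ZMod d) = 0 := by linear_combination -h
        have h4 : (4 : ZMod d) = 0 := by linear_combination 4 * this
        rw [h4, ZMod.val_zero] at hv4; omega)
      have e1 : ε (i + 1) = 1 := by rw [q0, sub_add_cancel, hp]
      rw [e0, e1] at hεi
      have : iot a0 = 1 ∧ iot C = 0 := by omega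
      rw [q0, sub_self, ZMod.val_zero]
      revert this
      cases a0 <;> cases C <;> simp [iot, ok]
    · have e1 : ε (i + 1) = 0 := hpu _ (by intro h; exact q0 (by rw [← h]; ring))
      have n0 : (4 * i - 4 * (p - 1)).val ≠ 0 := by
        intro h; rw [ZMod.val_eq_zero] at h
        apply q0
        have := congrArg (fun t => g * t) h
        simp only [mul_sub, mul_zero] at this
        rw [inv4, inv4] at this
        linear_combination this - (1 : ZMod d) * hg
      by_cases q4 : i = p
      · rw [q4, hp, ← q4, e1] at hεi
        have : iot a0 = 0 ∧ iot C = 1 := by omega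
        rw [q4, show 4 * p - 4 * (p - 1) = 4 by ring, hv4]
        revert this
        cases a0 <;> cases C <;> simp [iot, ok]
      · have n4 : (4 * i - 4 * (p - 1)).val ≠ 4 := by
          intro h
          rw [← hv4] at h
          have h := ZMod.val_injective d h
          apply q4
          have := congrArg (fun t => g * t) (show 4 * i = 4 * p by linear_combination h)
          simp only [inv4] at this
          exact this
        rw [hpu i q4, e1] at hεi
        rw [ok, if_neg n0, if_neg n4]
        have : iot a0 ≤ iot C := by omega
        revert this
        cases a0 <;> cases C <;> simp [iot]
  · funext i
    simp only [inv4]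
    rw [io α α01]

theorem Loc_unique (h1 : (e1 : ZMod d) = 2 * g) (h2 : (e2 : ZMod d) = g)
    (hg : 4 * g = 1) (hd : 5 ≤ d) (q q' : ZMod d) (a f f' : ZMod d → Bool) (hL : Loc q a f)
    (hL' : Loc q' a f') : q = q' ∧ f = f' := by
  have inv4 : ∀ j : ZMod d, 4 * (g * j) = j := fun j => by rw [← mul_assoc, hg, one_mul]
  obtain ⟨x, hx0, hx, hbx, hc, -⟩ := forward g e1 e2 h1 h2 hg hd q a f hL
  obtain ⟨x', hx0', hx', hbx', hc', -⟩ := forward g e1 e2 h1 h2 hg hd q' a f' hL'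
  have hxx : x = x' := by
    have e1 := XX_bt d x (by omega)
    have e2 := XX_bt d x' (by omega)
    rw [hbx] at e1
    rw [hbx', e1] at e2
    exact_mod_cast e2
  rw [← hxx, hc] at hc'
  have hff : f = f' := by
    funext j
    have hj := (hL j).1
    have hj' := (hL' j).1
    have hcc := iot_inj (congrFun hc' (g * j))
    simp only [inv4] at hcc
    revert hcc
    cases a (j - 2) <;> cases a (j - 1) <;> cases f j <;> cases f' j <;> simp
  refine ⟨?_, hff⟩
  subst hff
  have hv4 : (4 : ZMod d).val = 4 := by
    have := ZMod.val_natCast_of_lt (n := d) (a := 4) (by omega)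
    simpa using this
  have hq := (hL q).2
  have hq' := (hL' q).2
  rw [sub_self, ZMod.val_zero] at hq
  revert hq hq'
  generalize xor (xor (a (q - 2)) (a (q - 1))) (f q) = C
  intro hq' hq
  by_cases n0 : (q - q').val = 0
  · rw [ZMod.val_eq_zero] at n0; exact sub_eq_zero.mp n0
  · exfalso
    simp only [ok, if_neg n0, if_true] at hq hq'
    revert hq hq'
    split_ifs <;> cases a q <;> cases C <;> simp

theorem B_triples (h1 : (e1 : ZMod d) = 2 * g) (h2 : (e2 : ZMod d) = g)
    (hg : 4 * g = 1) (hd : 5 ≤ d) :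
    B (2 ^ e1 + 2 ^ e2) d = (Finset.univ.filter
      (fun x : ZMod d × ((ZMod d → Bool) × (ZMod d → Bool)) => Loc x.1 x.2.1 x.2.2)).card := by
  have inv4 : ∀ j : ZMod d, 4 * (g * j) = j := fun j => by rw [← mul_assoc, hg, one_mul]
  unfold B
  symm
  refine Finset.card_bij (fun x _ => (XX (fun i => iot (x.2.1 (4 * i))) 0).toNat) ?_ ?_ ?_
  · rintro ⟨q, a, f⟩ h
    simp only [Finset.mem_filter, Finset.mem_univ, true_and] at h
    obtain ⟨x, hx0, hx, hbx, hc, hs⟩ := forward g e1 e2 h1 h2 hg hd q a f h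
    have : (XX (fun i => iot (a (4 * i))) 0).toNat = x := by
      rw [← hbx, XX_bt d x (by omega)]; simp
    simp only [this, Finset.mem_filter, Finset.mem_Ioo]
    exact ⟨⟨hx0, hx⟩, hs⟩
  · rintro ⟨q, a, f⟩ h ⟨q', a', f'⟩ h' heq
    simp only [Finset.mem_filter, Finset.mem_univ, true_and] at h h' heq
    have nn : ∀ a : ZMod d → Bool, 0 ≤ XX (fun i => iot (a (4 * i))) 0 := fun a =>
      Finset.sum_nonneg fun t _ => by
        have : 0 ≤ iot (a (4 * (0 + (t : ZMod d)))) := by have := iot01 (a (4 * (0 + (t : ZMod d)))); omega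
        positivity
    have e : XX (fun i => iot (a (4 * i))) 0 = XX (fun i => iot (a' (4 * i))) 0 := by
      have := nn a; have := nn a'; omega
    have e2' := XX_inj _ _ (fun i => iot01 _) (fun i => iot01 _) e
    have haa : a = a' := by
      funext j
      have := iot_inj (congrFun e2' (g * j))
      rwa [inv4] at this
    subst haa
    obtain ⟨r1, r2⟩ := Loc_unique g e1 e2 h1 h2 hg hd q q' a f f' h h'
    rw [r1, r2]
  · intro x hx
    simp only [Finset.mem_filter, Finset.mem_Ioo] at hx
    obtain ⟨⟨hx0, hxm⟩, hs⟩ := hx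
    obtain ⟨q, a, f, hL, hb⟩ := backward g e1 e2 h1 h2 hg hd x hx0 hxm hs
    refine ⟨(q, a, f), by simpa using hL, ?_⟩
    simp only
    rw [← hb, XX_bt d x (by omega)]; simp

theorem Loc_shift (q : ZMod d) (a f : ZMod d → Bool) :
    Loc q a f ↔ Loc 0 (fun j => a (j + q)) (fun j => f (j + q)) := by
  constructor
  · intro h j
    have := h (j + q)
    simp only [sub_zero, add_sub_cancel_right] at this ⊢
    rw [show j + 4 + q = j + q + 4 by ring, show j - 2 + q = j + q - 2 by ring,
      show j - 1 + q = j + q - 1 by ring]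
    exact this
  · intro h j
    have := h (j - q)
    simp only [sub_zero, sub_add_cancel] at this
    rw [show j - q + 4 + q = j + 4 by ring, show j - q - 2 + q = j - 2 by ring,
      show j - q - 1 + q = j - 1 by ring] at this
    exact this

theorem card_triples : (Finset.univ.filter
      (fun x : ZMod d × ((ZMod d → Bool) × (ZMod d → Bool)) => Loc x.1 x.2.1 x.2.2)).card
    = d * (Finset.univ.filter
      (fun x : (ZMod d → Bool) × (ZMod d → Bool) => Loc 0 x.1 x.2)).card := by
  have hd : ∀ N, d * N = (Finset.univ : Finset (ZMod d)).card * N := fun N => by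
    rw [Finset.card_univ, ZMod.card]
  rw [hd, ← Finset.card_product]
  refine Finset.card_bij' (fun x _ => (x.1, (fun j => x.2.1 (j + x.1), fun j => x.2.2 (j + x.1))))
    (fun x _ => (x.1, (fun j => x.2.1 (j - x.1), fun j => x.2.2 (j - x.1)))) ?_ ?_ ?_ ?_
  · rintro ⟨q, a, f⟩ h
    simp only [Finset.mem_filter, Finset.mem_univ, true_and, Finset.mem_product] at h ⊢
    exact (Loc_shift q a f).mp h
  · rintro ⟨q, a, f⟩ h
    simp only [Finset.mem_filter, Finset.mem_univ, true_and, Finset.mem_product] at h ⊢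
    rw [Loc_shift]
    simpa using h
  · rintro ⟨q, a, f⟩ h
    simp
  · rintro ⟨q, a, f⟩ h
    simp

end main

theorem AGI_eq (n : ℕ) (ho : Odd (n + 5)) : AGI (n + 5) = (tot n : ℚ) := by
  have key : ∃ e2 : ℕ, gam (n + 5) = 2 ^ e2 ∧ (4 * (e2 : ZMod (n + 5)) = 1) := by
    have hodd : (n + 5) % 4 = 1 ∨ (n + 5) % 4 = 3 := by
      have := Nat.odd_iff.mp ho; omega
    have cast : ∀ e c : ℕ, 4 * e = c * (n + 5) + 1 → 4 * (e : ZMod (n + 5)) = 1 := by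
      intro e c h
      have := congrArg (fun t : ℕ => (t : ZMod (n + 5))) h
      simp only [Nat.cast_mul, Nat.cast_add (c * (n + 5)), ZMod.natCast_self, mul_zero] at this
      simpa using this
    rcases hodd with h | h
    · refine ⟨(3 * (n + 5) + 1) / 4, by rw [gam, if_pos h], cast _ 3 (by omega)⟩
    · refine ⟨((n + 5) + 1) / 4, by rw [gam, if_neg (by omega)], cast _ 1 (by omega)⟩
  obtain ⟨e2, hgam, hg⟩ := key
  have he1 : ((((n + 5) + 1) / 2 : ℕ) : ZMod (n + 5)) = 2 * (e2 : ZMod (n + 5)) := by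
    have h2 : 2 * (((n + 5) + 1) / 2) = (n + 5) + 1 := by
      have := Nat.odd_iff.mp ho; omega
    have h3 := congrArg (fun t : ℕ => (t : ZMod (n + 5))) h2
    simp only [Nat.cast_mul, Nat.cast_add (n + 5), ZMod.natCast_self] at h3
    generalize ((((n + 5) + 1) / 2 : ℕ) : ZMod (n + 5)) = E at *
    have h4 : 2 * E = 1 := by simpa using h3
    linear_combination (-E) * hg + 2 * (e2 : ZMod (n + 5)) * h4
  have hB := B_triples (d := n + 5) (e2 : ZMod (n + 5)) (((n + 5) + 1) / 2) e2 he1 rfl hg (by omega)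
  rw [card_triples] at hB
  unfold AGI
  rw [hgam, hB, ← card_Loc0 n]
  have : ((n + 5 : ℕ) : ℚ) ≠ 0 := by positivity
  push_cast at this ⊢
  field_simp
  
theorem AGI_three : AGI 3 = 1 := by
  have : B (2 ^ ((3 + 1) / 2) + gam 3) 3 = 3 := by decide +kernel
  unfold AGI
  rw [this]; norm_num

/-- The Glynn type (I) quantities `A_{σ+γ}(d)` satisfy the stated initial values and
the five-term recurrence for odd `d ≥ 13`. -/
theorem stmt_11 :
    AGI 3 = 1 ∧ AGI 5 = 1 ∧ AGI 7 = 3 ∧ AGI 9 = 7 ∧ AGI 11 = 13 ∧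
    ∀ d : ℕ, Odd d → 13 ≤ d →
      AGI d = AGI (d - 2) + AGI (d - 4) + AGI (d - 6) + AGI (d - 8) - 1 := by
  obtain ⟨t0, t2, t4, t6, -⟩ := tot_vals
  refine ⟨AGI_three, ?_, ?_, ?_, ?_, ?_⟩
  · rw [AGI_eq 0 (by decide), t0]; norm_num
  · rw [AGI_eq 2 (by decide), t2]; norm_num
  · rw [AGI_eq 4 (by decide), t4]; norm_num
  · rw [AGI_eq 6 (by decide), t6]; norm_num
  · intro d hd h13
    obtain ⟨n, rfl⟩ := Nat.exists_eq_add_of_le' h13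
    have par : ∀ m, m % 2 = n % 2 → Odd (m + 5) := by
      intro m hm
      rw [Nat.odd_iff] at hd ⊢
      omega
    have r := tot_rec n
    rw [show n + 13 - 2 = n + 6 + 5 by omega, show n + 13 - 4 = n + 4 + 5 by omega,
      show n + 13 - 6 = n + 2 + 5 by omega, show n + 13 - 8 = n + 5 by omega,
      show n + 13 = n + 8 + 5 by omega,
      AGI_eq _ (par _ (by omega)), AGI_eq _ (par _ (by omega)), AGI_eq _ (par _ (by omega)),
      AGI_eq _ (par _ (by omega)), AGI_eq _ (par _ (by omega)), r]
    push_cast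
    ring
end
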